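/- Let g₁,…,g_m ∈ ℝ[x₁,…,xₙ] and suppose K = {x ∈ ℝⁿ : g_j(x) ≥ 0 for j = 1,…,m} is compact. Let f ∈ ℝ[x₁,…,xₙ,t] be of the form f(x,t) = Σ_{k=0}^{2d} f_k(x) t^k with f_k ∈ ℝ[x₁,…,xₙ] and d ∈ ℕ, where f_{2d}(x) > 0 for all x ∈ K. If f(x,t) > 0 for all (x,t) ∈ K × ℝ, then f belongs to the preordering P(g), i.e. f = Σ_{β ∈ {0,1}^m} ψ_β · g₁^{β₁} ⋯ g_m^{β_m} for some sum-of-squares polynomials ψ_β ∈ Σ[x,t]. -/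

import Mathlib

open Polynomial

/-- The intermediate value property for polynomials over an ordered field. -/
def PolyIVT (R : Type*) [Field R] [LinearOrder R] : Prop :=
  ∀ (p : R[X]) (a b : R), a < b → p.eval a * p.eval b < 0 → ∃ c, a < c ∧ c < b ∧ p.eval c = 0

section OrderedField

variable {R : Type*} [Field R] [LinearOrder R] [IsStrictOrderedRing R]

lemma Polynomial.exists_nhd_pos_of_eval_pos (p : R[X]) (w : R) (h : 0 < p.eval w) :
    ∃ l u, l < w ∧ w < u ∧ ∀ y, l < y → y < u → 0 < p.eval y := by
  let _ := Preorder.topology R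
  have : OrderTopology R := ⟨rfl⟩
  have h1 : ∀ᶠ y in nhds w, 0 < p.eval y :=
    p.continuous.continuousAt.eventually (lt_mem_nhds h)
  obtain ⟨l, u, ⟨hl, hu⟩, hs⟩ := mem_nhds_iff_exists_Ioo_subset.1 h1
  exact ⟨l, u, hl, hu, fun y h1 h2 => hs ⟨h1, h2⟩⟩

lemma Polynomial.exists_lt_eval_pos (p : R[X]) {a w : R} (haw : a < w) (h : 0 < p.eval w) :
    ∃ y, a < y ∧ y < w ∧ 0 < p.eval y := by
  obtain ⟨l, u, hl, hu, H⟩ := p.exists_nhd_pos_of_eval_pos w h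
  obtain ⟨y, hy1, hy2⟩ := exists_between (max_lt haw hl)
  exact ⟨y, lt_of_le_of_lt (le_max_left _ _) hy1, hy2,
    H y (lt_of_le_of_lt (le_max_right _ _) hy1) (hy2.trans hu)⟩

/-- Near a root with positive derivative, a polynomial changes sign from negative to positive. -/
lemma Polynomial.exists_nhd_sign_of_root (p : R[X]) (r : R) (h0 : p.eval r = 0)
    (h : 0 < p.derivative.eval r) :
    ∃ l u, l < r ∧ r < u ∧ (∀ y, l < y → y < r → p.eval y < 0) ∧
      (∀ y, r < y → y < u → 0 < p.eval y) := by
  obtain ⟨q, rfl⟩ := dvd_iff_isRoot.2 h0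
  have hq : 0 < q.eval r := by simpa using h
  obtain ⟨l, u, hl, hu, H⟩ := q.exists_nhd_pos_of_eval_pos r hq
  refine ⟨l, u, hl, hu, fun y h1 h2 => ?_, fun y h1 h2 => ?_⟩
  · have := H y h1 (h2.trans hu)
    simp only [eval_mul, eval_sub, eval_X, eval_C]
    exact mul_neg_of_neg_of_pos (by linarith) this
  · have := H y (hl.trans h1) h2
    simp only [eval_mul, eval_sub, eval_X, eval_C]
    exact mul_pos (by linarith) this

lemma PolyIVT.pos_of_no_root (hR : PolyIVT R) (p : R[X]) {a b : R}
    (ha : 0 < p.eval a) (h : ∀ c, min a b ≤ c → c ≤ max a b → p.eval c ≠ 0) : 0 < p.eval b := by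
  by_contra hb
  have hb' : p.eval b < 0 :=
    lt_of_le_of_ne (not_lt.1 hb) (h b (min_le_right _ _) (le_max_right _ _))
  rcases lt_trichotomy a b with hab | hab | hab
  · obtain ⟨c, h1, h2, h3⟩ := hR p a b hab (mul_neg_of_pos_of_neg ha hb')
    exact h c ((min_le_left _ _).trans h1.le) (h2.le.trans (le_max_right _ _)) h3
  · subst hab; linarith
  · obtain ⟨c, h1, h2, h3⟩ := hR p b a hab (mul_neg_of_neg_of_pos hb' ha)
    exact h c ((min_le_right _ _).trans h1.le) (h2.le.trans (le_max_left _ _)) h3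

lemma PolyIVT.sign_eq_of_no_root (hR : PolyIVT R) (p : R[X]) {a b : R}
    (h : ∀ c, min a b ≤ c → c ≤ max a b → p.eval c ≠ 0) :
    SignType.sign (p.eval a) = SignType.sign (p.eval b) := by
  rcases lt_or_gt_of_ne (h a (min_le_left _ _) (le_max_left _ _)) with ha | ha
  · have := hR.pos_of_no_root (-p) (a := a) (b := b) (by simpa using ha)
      (fun c h1 h2 => by simpa using h c h1 h2)
    rw [sign_neg ha, sign_neg (by simpa using this)]
  · rw [sign_pos ha, sign_pos (hR.pos_of_no_root p ha h)]

lemma PolyIVT.eval_lt_of_derivative_pos (hR : PolyIVT R) (p : R[X]) {a b : R} (hab : a < b)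
    (h : ∀ c, a ≤ c → c ≤ b → 0 < p.derivative.eval c) : p.eval a < p.eval b := by
  by_contra hcon
  set q := p - C (p.eval a) with hq
  have hqd : q.derivative = p.derivative := by simp [hq]
  have hqa : q.eval a = 0 := by simp [hq]
  have hqb : q.eval b ≤ 0 := by simpa [hq] using hcon
  have hq0 : q ≠ 0 := by
    intro h0
    have := h a le_rfl hab.le
    rw [← hqd, h0] at this
    simp at this
  obtain ⟨_, u, -, hu, -, H⟩ :=
    q.exists_nhd_sign_of_root a hqa (by rw [hqd]; exact h a le_rfl hab.le)
  obtain ⟨a', ha1, ha2⟩ := exists_between (lt_min hu hab)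
  have hqa' := H a' ha1 (ha2.trans_le (min_le_left _ _))
  have ha'b : a' < b := ha2.trans_le (min_le_right _ _)
  classical
  let Z := q.roots.toFinset.filter (fun c => a < c ∧ c ≤ b)
  have hZ : Z.Nonempty := by
    rcases hqb.lt_or_eq with hb | hb
    · obtain ⟨c, h1, h2, h3⟩ := hR q a' b ha'b (mul_neg_of_pos_of_neg hqa' hb)
      exact ⟨c, by simp [Z, hq0, h3, ha1.trans h1, h2.le]⟩
    · exact ⟨b, by simp [Z, hq0, hb, hab]⟩
  obtain ⟨hr1, hr2⟩ := Finset.mem_filter.1 (Z.min'_mem hZ)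
  set r := Z.min' hZ with hr
  have hqr : q.eval r = 0 := by simpa [hq0] using hr1
  obtain ⟨l, _, hl, -, Hl, -⟩ :=
    q.exists_nhd_sign_of_root r hqr (by rw [hqd]; exact h r hr2.1.le hr2.2)
  obtain ⟨s, hs1, hs2⟩ := exists_between (max_lt hl hr2.1)
  have hqs := Hl s ((le_max_left _ _).trans_lt hs1) hs2
  have has : a < s := (le_max_right _ _).trans_lt hs1
  have har : a' < r := by
    by_contra hcon2
    rcases (not_lt.1 hcon2).lt_or_eq with h1 | h1
    · exact absurd (H r hr2.1 (h1.trans (ha2.trans_le (min_le_left _ _)))) (by simp [hqr])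
    · rw [h1] at hqr; linarith
  have := hR.pos_of_no_root q (a := a') (b := s) hqa' (fun c h1 h2 h3 => by
    have hc1 : a < c := (lt_min ha1 has).trans_le h1
    have hc2 : c < r := h2.trans_lt (max_lt har hs2)
    have : c ∈ Z := by simp [Z, hq0, h3, hc1, hc2.le.trans hr2.2]
    exact absurd (Z.min'_le c this) (not_le.2 hc2))
  linarith

lemma PolyIVT.eval_lt_of_derivative_neg (hR : PolyIVT R) (p : R[X]) {a b : R} (hab : a < b)
    (h : ∀ c, a ≤ c → c ≤ b → p.derivative.eval c < 0) : p.eval b < p.eval a := by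
  have := hR.eval_lt_of_derivative_pos (-p) hab (fun c h1 h2 => by simpa using h c h1 h2)
  simpa using this

lemma Polynomial.exists_forall_ge_of_leadingCoeff_pos :
    ∀ (n : ℕ) (p : R[X]), p.natDegree = n + 1 → 0 < p.leadingCoeff → ∀ B : R,
      ∃ M, ∀ y, M ≤ y → B ≤ p.eval y := by
  intro n
  induction n with
  | zero =>
    intro p hp hl B
    have h1 := p.divX_mul_X_add
    have h2 : p.divX = C p.leadingCoeff := by
      rw [eq_C_of_natDegree_eq_zero (p := p.divX)
          (by rw [natDegree_divX_eq_natDegree_tsub_one, hp]),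
        coeff_divX, leadingCoeff, hp]
    refine ⟨(B - p.coeff 0) / p.leadingCoeff, fun y hy => ?_⟩
    rw [div_le_iff₀ hl] at hy
    rw [← h1, h2]
    simp only [eval_add, eval_mul, eval_C, eval_X]
    linarith
  | succ n ih =>
    intro p hp hl B
    have h1 := p.divX_mul_X_add
    have hd : p.divX.natDegree = n + 1 := by rw [natDegree_divX_eq_natDegree_tsub_one, hp]; rfl
    have hl' : 0 < p.divX.leadingCoeff := by
      rw [leadingCoeff, hd, coeff_divX]
      rwa [leadingCoeff, hp] at hl
    obtain ⟨M, hM⟩ := ih p.divX hd hl' 1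
    refine ⟨max (max M 0) (B - p.coeff 0), fun y hy => ?_⟩
    have h3 := hM y (((le_max_left _ _).trans (le_max_left _ _)).trans hy)
    have h4 : 0 ≤ y := ((le_max_right _ _).trans (le_max_left _ _)).trans hy
    have h5 : B - p.coeff 0 ≤ y := (le_max_right _ _).trans hy
    rw [← h1]
    simp only [eval_add, eval_mul, eval_C, eval_X]
    nlinarith

lemma Polynomial.exists_forall_ge_pos_of_leadingCoeff_pos (p : R[X]) (hl : 0 < p.leadingCoeff) :
    ∃ M, ∀ y, M ≤ y → 0 < p.eval y := by
  rcases Nat.eq_zero_or_pos p.natDegree with h | h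
  · rw [eq_C_of_natDegree_eq_zero h] at hl ⊢
    exact ⟨0, fun y _ => by simpa using hl⟩
  · obtain ⟨M, hM⟩ := p.exists_forall_ge_of_leadingCoeff_pos (p.natDegree - 1)
      (by omega) hl 1
    exact ⟨M, fun y hy => zero_lt_one.trans_le (hM y hy)⟩

/-- A polynomial whose derivative is positive on a half-line is eventually positive. -/
lemma Polynomial.exists_gt_eval_pos_of_derivative_pos (p : R[X]) (a : R)
    (h : ∀ c, a ≤ c → 0 < p.derivative.eval c) : ∃ y, a < y ∧ 0 < p.eval y := by
  have hd : p.natDegree ≠ 0 := by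
    intro h0
    have := h a le_rfl
    rw [eq_C_of_natDegree_eq_zero h0] at this
    simp at this
  have hp0 : p.derivative.leadingCoeff = p.leadingCoeff * p.natDegree := by
    rw [leadingCoeff_derivative]
  have hn : (0 : R) < p.natDegree := by exact_mod_cast Nat.pos_of_ne_zero hd
  rcases lt_trichotomy p.leadingCoeff 0 with hl | hl | hl
  · obtain ⟨M, hM⟩ := (-p.derivative).exists_forall_ge_pos_of_leadingCoeff_pos
      (by rw [leadingCoeff_neg, hp0]; nlinarith)
    have h1 := hM (max M a) (le_max_left _ _)
    have h2 := h (max M a) (le_max_right _ _)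
    simp only [eval_neg] at h1
    linarith
  · exact absurd (leadingCoeff_eq_zero.1 hl) (by rintro rfl; simp at hd)
  · obtain ⟨M, hM⟩ := p.exists_forall_ge_pos_of_leadingCoeff_pos hl
    exact ⟨max M (a + 1), lt_of_lt_of_le (by linarith) (le_max_right _ _), hM _ (le_max_left _ _)⟩

end OrderedField

section SignTransfer

set_option linter.unusedSectionVars false

variable {R₁ R₂ : Type*} [Field R₁] [LinearOrder R₁] [IsStrictOrderedRing R₁]
  [Field R₂] [LinearOrder R₂] [IsStrictOrderedRing R₂]

/-- The points `x` and `y` give the same signs to all pairs of polynomials in `S`. -/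
def SignMatch (S : Set (R₁[X] × R₂[X])) (x : R₁) (y : R₂) : Prop :=
  ∀ s ∈ S, SignType.sign (s.1.eval x) = SignType.sign (s.2.eval y)

/-- The point `x` is a root of a nonzero first component of `S`. -/
def IsRootOf (S : Set (R₁[X] × R₂[X])) (x : R₁) : Prop :=
  ∃ s ∈ S, s.1 ≠ 0 ∧ s.1.eval x = 0

/-- The families of first and second components of `S` have the same sign diagram. -/
structure SameSigns (S : Set (R₁[X] × R₂[X])) : Prop where
  forth : ∀ x, ∃ y, SignMatch S x y
  back : ∀ y, ∃ x, SignMatch S x y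
  ord : ∀ x y x' y', SignMatch S x y → SignMatch S x' y' → x < x' → y' ≤ y → SignMatch S x y'

lemma signMatch_swap {S : Set (R₁[X] × R₂[X])} {x : R₁} {y : R₂} :
    SignMatch (Prod.swap '' S) y x ↔ SignMatch S x y := by
  simp only [SignMatch, Set.mem_image, forall_exists_index, and_imp, forall_apply_eq_imp_iff₂,
    Prod.fst_swap, Prod.snd_swap]
  exact ⟨fun h s hs => (h s hs).symm, fun h s hs => (h s hs).symm⟩

lemma SignMatch.trans' {S : Set (R₁[X] × R₂[X])} {x u : R₁} {y v : R₂}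
    (h1 : SignMatch S x y) (h2 : SignMatch S u y) (h3 : SignMatch S u v) : SignMatch S x v :=
  fun s hs => (h1 s hs).trans ((h2 s hs).symm.trans (h3 s hs))

/-- Composition of all polynomials of a family with `-X`. -/
def reflectFamily (S : Set (R₁[X] × R₂[X])) : Set (R₁[X] × R₂[X]) :=
  (fun s => (s.1.comp (-X), s.2.comp (-X))) '' S

lemma signMatch_reflect {S : Set (R₁[X] × R₂[X])} {x : R₁} {y : R₂} :
    SignMatch (reflectFamily S) x y ↔ SignMatch S (-x) (-y) := by
  simp only [SignMatch, reflectFamily, Set.forall_mem_image]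
  simp

namespace SameSigns

variable {S : Set (R₁[X] × R₂[X])}

lemma swap (h : SameSigns S) : SameSigns (Prod.swap '' S) where
  forth y := by simpa only [signMatch_swap] using h.back y
  back x := by simpa only [signMatch_swap] using h.forth x
  ord y x y' x' h1 h2 hlt hle := by
    rw [signMatch_swap] at *
    rcases hle.lt_or_eq with hlt' | rfl
    · exact h.ord x' y' x y h2 h1 hlt' hlt.le
    · exact h1

lemma reflect (h : SameSigns S) : SameSigns (reflectFamily S) where
  forth x := by
    obtain ⟨y, hy⟩ := h.forth (-x)
    exact ⟨-y, signMatch_reflect.2 (by simpa using hy)⟩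
  back y := by
    obtain ⟨x, hx⟩ := h.back (-y)
    exact ⟨-x, signMatch_reflect.2 (by simpa using hx)⟩
  ord x y x' y' h1 h2 hlt hle := by
    rw [signMatch_reflect] at *
    rcases hle.lt_or_eq with hlt' | rfl
    · have := h.ord (-x') (-y') (-x) (-y) h2 h1 (by linarith) (by linarith)
      exact h1.trans' this h2
    · exact h1

lemma snd_eq_zero (h : SameSigns S) {s : R₁[X] × R₂[X]} (hs : s ∈ S) (h0 : s.1 = 0) :
    s.2 = 0 := by
  refine Polynomial.funext fun y => ?_
  obtain ⟨x, hx⟩ := h.back y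
  have := hx s hs
  rw [h0, eval_zero, sign_zero, eq_comm, sign_eq_zero_iff] at this
  simpa using this

lemma fst_eq_zero (h : SameSigns S) {s : R₁[X] × R₂[X]} (hs : s ∈ S) (h0 : s.2 = 0) :
    s.1 = 0 := by
  refine Polynomial.funext fun x => ?_
  obtain ⟨y, hy⟩ := h.forth x
  have := hy s hs
  rw [h0, eval_zero, sign_zero, sign_eq_zero_iff] at this
  simpa using this

lemma isRootOf_iff (h : SameSigns S) {x : R₁} {y : R₂} (hxy : SignMatch S x y) :
    IsRootOf S x ↔ IsRootOf (Prod.swap '' S) y := by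
  constructor
  · rintro ⟨s, hs, h0, he⟩
    refine ⟨s.swap, ⟨s, hs, rfl⟩, fun h2 => h0 (h.fst_eq_zero hs h2), ?_⟩
    have := hxy s hs
    rwa [he, sign_zero, eq_comm, sign_eq_zero_iff] at this
  · rintro ⟨_, ⟨s, hs, rfl⟩, h0, he⟩
    refine ⟨s, hs, fun h2 => h0 (h.snd_eq_zero hs h2), ?_⟩
    have := hxy s hs
    simp only [Prod.fst_swap] at he
    rwa [he, sign_zero, sign_eq_zero_iff] at this

/-- Sign classes are convex. -/
lemma convex (h : SameSigns S) {x x' u : R₁} {y : R₂} (h1 : SignMatch S x y)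
    (h2 : SignMatch S x' y) (hx : x ≤ u) (hx' : u ≤ x') : SignMatch S u y := by
  rcases hx.eq_or_lt with rfl | hx
  · exact h1
  rcases hx'.eq_or_lt with rfl | hx'
  · exact h2
  obtain ⟨v, hv⟩ := h.forth u
  rcases le_total v y with hvy | hvy
  · exact hv.trans' (h.ord x y u v h1 hv hx hvy) h1
  · exact h.ord u v x' y hv h2 hx' hvy

end SameSigns

lemma finite_isRootOf {S : Set (R₁[X] × R₂[X])} (hS : S.Finite) : {x | IsRootOf S x}.Finite := by
  have : {x | IsRootOf S x} ⊆ ⋃ s ∈ S, (s.1.roots.toFinset : Set R₁) := by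
    rintro x ⟨s, hs, h0, he⟩
    simp only [Set.mem_iUnion]
    exact ⟨s, hs, by simp [h0, he]⟩
  exact (hS.biUnion fun s _ => Finset.finite_toSet _).subset this

lemma exists_least_isRootOf {S : Set (R₁[X] × R₂[X])} (hS : S.Finite) {x : R₁}
    (h : ∃ u, x < u ∧ IsRootOf S u) :
    ∃ v, x < v ∧ IsRootOf S v ∧ ∀ u, x < u → IsRootOf S u → v ≤ u := by
  have hf : {u | x < u ∧ IsRootOf S u}.Finite := (finite_isRootOf hS).subset fun u hu => hu.2
  obtain ⟨v, hv, hmin⟩ := Set.exists_min_image _ id hf h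
  exact ⟨v, hv.1, hv.2, fun u h1 h2 => hmin u ⟨h1, h2⟩⟩

lemma SignMatch.congr_of_no_root (hR₁ : PolyIVT R₁) {S : Set (R₁[X] × R₂[X])} {a b : R₁} {y : R₂}
    (h : SignMatch S a y) (hab : ∀ c, min a b ≤ c → c ≤ max a b → ¬ IsRootOf S c) :
    SignMatch S b y := by
  intro s hs
  rw [← h s hs]
  by_cases h0 : s.1 = 0
  · simp [h0]
  · exact (hR₁.sign_eq_of_no_root s.1 fun c h1 h2 h3 => hab c h1 h2 ⟨s, hs, h0, h3⟩).symm

lemma SignMatch.congr_right_of_no_root (hR₂ : PolyIVT R₂) {S : Set (R₁[X] × R₂[X])} {x : R₁}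
    {a b : R₂} (h : SignMatch S x a)
    (hab : ∀ c, min a b ≤ c → c ≤ max a b → ¬ IsRootOf (Prod.swap '' S) c) :
    SignMatch S x b :=
  signMatch_swap.1 ((signMatch_swap.2 h).congr_of_no_root hR₂ hab)

/-- Sign classes without roots are open. -/
lemma SignMatch.exists_nhd (hR₁ : PolyIVT R₁) {S : Set (R₁[X] × R₂[X])} (hS : S.Finite) {x : R₁}
    {y : R₂} (h : SignMatch S x y) (hx : ¬ IsRootOf S x) :
    ∃ l u, l < x ∧ x < u ∧ ∀ v, l < v → v < u → SignMatch S v y := by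
  let _ := Preorder.topology R₁
  have : OrderTopology R₁ := ⟨rfl⟩
  have h1 : {u | IsRootOf S u}ᶜ ∈ nhds x := (finite_isRootOf hS).isClosed.isOpen_compl.mem_nhds hx
  obtain ⟨l, u, ⟨hl, hu⟩, hs⟩ := mem_nhds_iff_exists_Ioo_subset.1 h1
  refine ⟨l, u, hl, hu, fun v h1 h2 => h.congr_of_no_root hR₁ fun c h3 h4 => hs ⟨?_, ?_⟩⟩
  · exact (lt_min hl h1).trans_le h3
  · exact h4.trans_lt (max_lt hu h2)

lemma SameSigns.exists_pos_of_derivative_pos (hR₁ : PolyIVT R₁) (hR₂ : PolyIVT R₂)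
    {S : Set (R₁[X] × R₂[X])} (hS : S.Finite) (h : SameSigns S) (P : R₁[X]) (Q : R₂[X])
    (hd : ∀ x y, SignMatch S x y →
      SignType.sign (P.derivative.eval x) = SignType.sign (Q.derivative.eval y))
    (hroot : ∀ x y, SignMatch S x y → IsRootOf S x →
      SignType.sign (P.eval x) = SignType.sign (Q.eval y))
    {x : R₁} (hx : ¬ IsRootOf S x) (hdx : 0 < P.derivative.eval x) (hPx : 0 < P.eval x) :
    ∃ y, SignMatch S x y ∧ 0 < Q.eval y := by
  by_contra! hcon
  obtain ⟨y, hxy⟩ := h.forth x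
  have hS' : (Prod.swap '' S).Finite := hS.image _
  have hy : ¬ IsRootOf (Prod.swap '' S) y := fun hy => hx ((h.isRootOf_iff hxy).2 hy)
  have hd2 : ∀ v, SignMatch S x v → 0 < Q.derivative.eval v := fun v hv => by
    have := hd x v hv
    rwa [sign_pos hdx, eq_comm, sign_eq_one_iff] at this
  have hd1 : ∀ u, SignMatch S u y → 0 < P.derivative.eval u := fun u hu => by
    have := hd u y hu
    rwa [sign_pos (hd2 y hxy), sign_eq_one_iff] at this
  have right_of : ∀ u t, SignMatch S u t → IsRootOf S u → (x < u ↔ y < t) := by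
    intro u t hut hu
    have hne : x ≠ u := by rintro rfl; exact hx hu
    constructor
    · intro hlt
      by_contra hle
      have := h.ord x y u t hxy hut hlt (not_lt.1 hle)
      exact hx ((h.isRootOf_iff this).2 ((h.isRootOf_iff hut).1 hu))
    · intro hlt
      by_contra hle
      have := h.ord u t x y hut hxy (lt_of_le_of_ne (not_lt.1 hle) hne.symm) hlt.le
      exact hy ((h.isRootOf_iff this).1 hu)
  by_cases hw : ∃ w, y < w ∧ IsRootOf (Prod.swap '' S) w
  · obtain ⟨w, hyw, hwr, hwmin⟩ := exists_least_isRootOf hS' hw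
    obtain ⟨u, huw⟩ := h.back w
    have hur : IsRootOf S u := (h.isRootOf_iff huw).2 hwr
    have hxu : x < u := (right_of u w huw hur).2 hyw
    obtain ⟨v, hxv, hvr, hvmin⟩ := exists_least_isRootOf hS ⟨u, hxu, hur⟩
    obtain ⟨t, hvt⟩ := h.forth v
    have htr := (h.isRootOf_iff hvt).1 hvr
    have hyt : y < t := (right_of v t hvt hvr).1 hxv
    have hvw : SignMatch S v w := by
      rcases (hvmin u hxu hur).eq_or_lt with rfl | hvu
      · exact huw
      · exact h.ord v t u w hvt huw hvu (hwmin t hyt htr)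
    have hclass2 : ∀ c, y < c → c < w → SignMatch S x c := fun c h1 h2 =>
      hxy.congr_right_of_no_root hR₂ fun e h3 h4 her => by
        rw [min_eq_left h1.le] at h3
        rw [max_eq_right h1.le] at h4
        rcases h3.eq_or_lt with rfl | h3
        · exact hy her
        · exact absurd (hwmin e h3 her) (not_le.2 (h4.trans_lt h2))
    have hclass1 : ∀ c, x < c → c < v → SignMatch S c y := fun c h1 h2 =>
      hxy.congr_of_no_root hR₁ fun e h3 h4 her => by
        rw [min_eq_left h1.le] at h3
        rw [max_eq_right h1.le] at h4
        rcases h3.eq_or_lt with rfl | h3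
        · exact hx her
        · exact absurd (hvmin e h3 her) (not_le.2 (h4.trans_lt h2))
    have hQw : Q.eval w ≤ 0 := by
      by_contra hQw
      obtain ⟨c, h1, h2, h3⟩ := Q.exists_lt_eval_pos hyw (not_le.1 hQw)
      exact absurd (hcon c (hclass2 c h1 h2)) (not_le.2 h3)
    have hPv : P.eval v ≤ 0 := by
      have := hroot v w hvw hvr
      by_contra hpos
      rw [sign_pos (not_le.1 hpos), eq_comm, sign_eq_one_iff] at this
      linarith
    obtain ⟨c, h1, h2, h3⟩ := (C (P.eval x) - P).exists_lt_eval_pos hxv (by simp; linarith)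
    have := hR₁.eval_lt_of_derivative_pos P h1 (fun e he1 he2 => by
      rcases he1.eq_or_lt with rfl | he1
      · exact hdx
      · exact hd1 e (hclass1 e he1 (he2.trans_lt h2)))
    simp only [eval_sub, eval_C] at h3
    linarith
  · push Not at hw
    have hclass2 : ∀ c, y ≤ c → SignMatch S x c := fun c h1 =>
      hxy.congr_right_of_no_root hR₂ fun e h3 h4 her => by
        rw [min_eq_left h1] at h3
        rcases h3.eq_or_lt with rfl | h3
        · exact hy her
        · exact hw e h3 her
    obtain ⟨c, h1, h2⟩ := Q.exists_gt_eval_pos_of_derivative_pos y fun c hc => hd2 c (hclass2 c hc)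
    exact absurd (hcon c (hclass2 c h1.le)) (not_le.2 h2)

lemma isRootOf_reflect {S : Set (R₁[X] × R₂[X])} {x : R₁} :
    IsRootOf (reflectFamily S) x ↔ IsRootOf S (-x) := by
  have key : ∀ p : R₁[X], p.comp (-X) = 0 ↔ p = 0 := fun p =>
    ⟨fun h => by simpa [comp_assoc] using congrArg (fun q => q.comp (-X)) h,
      fun h => by simp [h]⟩
  simp [IsRootOf, reflectFamily, key]

lemma SameSigns.exists_pos (hR₁ : PolyIVT R₁) (hR₂ : PolyIVT R₂)
    {S : Set (R₁[X] × R₂[X])} (hS : S.Finite) (h : SameSigns S) (P : R₁[X]) (Q : R₂[X])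
    (hd : ∀ x y, SignMatch S x y →
      SignType.sign (P.derivative.eval x) = SignType.sign (Q.derivative.eval y))
    (hroot : ∀ x y, SignMatch S x y → IsRootOf S x →
      SignType.sign (P.eval x) = SignType.sign (Q.eval y))
    {x : R₁} (hx : ¬ IsRootOf S x) (hdx : P.derivative.eval x ≠ 0) (hPx : 0 < P.eval x) :
    ∃ y, SignMatch S x y ∧ 0 < Q.eval y := by
  rcases hdx.lt_or_gt with hneg | hpos
  · obtain ⟨y, h1, h2⟩ := h.reflect.exists_pos_of_derivative_pos hR₁ hR₂
      (show (reflectFamily S).Finite from hS.image _)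
      (P.comp (-X)) (Q.comp (-X))
      (fun x y hxy => by
        have := hd _ _ (signMatch_reflect.1 hxy)
        simp only [derivative_comp, derivative_neg, derivative_X, eval_neg, eval_comp, eval_X,
          neg_mul, one_mul, Left.sign_neg, this])
      (fun x y hxy hr => by
        simpa using hroot _ _ (signMatch_reflect.1 hxy) (isRootOf_reflect.1 hr))
      (x := -x) (by rwa [isRootOf_reflect, neg_neg])
      (by simpa [derivative_comp] using hneg) (by simpa using hPx)
    exact ⟨-y, by simpa using signMatch_reflect.1 h1, by simpa using h2⟩
  · exact h.exists_pos_of_derivative_pos hR₁ hR₂ hS P Q hd hroot hx hpos hPx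

lemma SameSigns.exists_neg (hR₁ : PolyIVT R₁) (hR₂ : PolyIVT R₂)
    {S : Set (R₁[X] × R₂[X])} (hS : S.Finite) (h : SameSigns S) (P : R₁[X]) (Q : R₂[X])
    (hd : ∀ x y, SignMatch S x y →
      SignType.sign (P.derivative.eval x) = SignType.sign (Q.derivative.eval y))
    (hroot : ∀ x y, SignMatch S x y → IsRootOf S x →
      SignType.sign (P.eval x) = SignType.sign (Q.eval y))
    {x : R₁} (hx : ¬ IsRootOf S x) (hdx : P.derivative.eval x ≠ 0) (hPx : P.eval x < 0) :
    ∃ y, SignMatch S x y ∧ Q.eval y < 0 := by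
  obtain ⟨y, h1, h2⟩ := h.exists_pos hR₁ hR₂ hS (-P) (-Q)
    (fun x y hxy => by simp [Left.sign_neg, hd x y hxy])
    (fun x y hxy hr => by simp [Left.sign_neg, hroot x y hxy hr]) hx
    (by simpa using hdx) (by simpa using hPx)
  exact ⟨y, h1, by simpa using h2⟩

lemma SameSigns.exists_sign_eq (hR₁ : PolyIVT R₁) (hR₂ : PolyIVT R₂)
    {S : Set (R₁[X] × R₂[X])} (hS : S.Finite) (h : SameSigns S) (P : R₁[X]) (Q : R₂[X])
    (hd : (P.derivative, Q.derivative) ∈ S) (hd0 : P.derivative ≠ 0)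
    (hroot : ∀ x y, SignMatch S x y → IsRootOf S x →
      SignType.sign (P.eval x) = SignType.sign (Q.eval y)) (x : R₁) :
    ∃ y, SignMatch S x y ∧ SignType.sign (P.eval x) = SignType.sign (Q.eval y) := by
  obtain ⟨y, hxy⟩ := h.forth x
  by_cases hx : IsRootOf S x
  · exact ⟨y, hxy, hroot x y hxy hx⟩
  have hd' : ∀ x y, SignMatch S x y →
      SignType.sign (P.derivative.eval x) = SignType.sign (Q.derivative.eval y) :=
    fun x y hxy => hxy _ hd
  have hdx : ∀ u, ¬ IsRootOf S u → P.derivative.eval u ≠ 0 := fun u hu h0 => hu ⟨_, hd, hd0, h0⟩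
  rcases lt_trichotomy (P.eval x) 0 with hP | hP | hP
  · obtain ⟨y, h1, h2⟩ := h.exists_neg hR₁ hR₂ hS P Q hd' hroot hx (hdx x hx) hP
    exact ⟨y, h1, by rw [sign_neg hP, sign_neg h2]⟩
  · obtain ⟨l, u, hl, hu, H⟩ := hxy.exists_nhd hR₁ hS hx
    obtain ⟨a, hla, hax⟩ := exists_between hl
    obtain ⟨b, hxb, hbu⟩ := exists_between hu
    have hnr : ∀ v, SignMatch S v y → ¬ IsRootOf S v := fun v hv hr =>
      hx ((h.isRootOf_iff hxy).2 ((h.isRootOf_iff hv).1 hr))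
    have hmatch : ∀ v, a ≤ v → v ≤ b → SignMatch S v y := fun v h1 h2 =>
      H v (hla.trans_le h1) (h2.trans_lt hbu)
    have ha := hmatch a le_rfl (hax.trans hxb).le
    have hb := hmatch b (hax.trans hxb).le le_rfl
    have hsd : ∀ v, a ≤ v → v ≤ b → SignType.sign (P.derivative.eval v) =
        SignType.sign (P.derivative.eval x) := fun v h1 h2 =>
      (hd' v y (hmatch v h1 h2)).trans (hd' x y hxy).symm
    have hends : (∃ v, SignMatch S v y ∧ 0 < P.eval v) ∧ (∃ v, SignMatch S v y ∧ P.eval v < 0) := by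
      rcases (hdx x hx).lt_or_gt with hn | hp
      · have hder : ∀ v, a ≤ v → v ≤ b → P.derivative.eval v < 0 := fun v h1 h2 => by
          have := hsd v h1 h2
          rwa [sign_neg hn, sign_eq_neg_one_iff] at this
        have h1 := hR₁.eval_lt_of_derivative_neg P hax fun c h1 h2 => hder c h1 (h2.trans hxb.le)
        have h2 := hR₁.eval_lt_of_derivative_neg P hxb fun c h1 h2 => hder c (hax.le.trans h1) h2
        exact ⟨⟨a, ha, by linarith⟩, ⟨b, hb, by linarith⟩⟩
      · have hder : ∀ v, a ≤ v → v ≤ b → 0 < P.derivative.eval v := fun v h1 h2 => by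
          have := hsd v h1 h2
          rwa [sign_pos hp, sign_eq_one_iff] at this
        have h1 := hR₁.eval_lt_of_derivative_pos P hax fun c h1 h2 => hder c h1 (h2.trans hxb.le)
        have h2 := hR₁.eval_lt_of_derivative_pos P hxb fun c h1 h2 => hder c (hax.le.trans h1) h2
        exact ⟨⟨b, hb, by linarith⟩, ⟨a, ha, by linarith⟩⟩
    obtain ⟨⟨v, hvy, hv⟩, ⟨v', hvy', hv'⟩⟩ := hends
    obtain ⟨c, hc, hQc⟩ := h.exists_pos hR₁ hR₂ hS P Q hd' hroot (hnr v hvy) (hdx v (hnr v hvy)) hv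
    obtain ⟨c', hc', hQc'⟩ :=
      h.exists_neg hR₁ hR₂ hS P Q hd' hroot (hnr v' hvy') (hdx v' (hnr v' hvy')) hv'
    have hxc := hxy.trans' hvy hc
    have hxc' := hxy.trans' hvy' hc'
    have hconv : ∀ e, min c c' ≤ e → e ≤ max c c' → SignMatch S x e := fun e h1 h2 => by
      rw [← signMatch_swap] at hxc hxc' ⊢
      rcases le_total c c' with hcc | hcc
      · rw [min_eq_left hcc] at h1
        rw [max_eq_right hcc] at h2
        exact h.swap.convex hxc hxc' h1 h2
      · rw [min_eq_right hcc] at h1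
        rw [max_eq_left hcc] at h2
        exact h.swap.convex hxc' hxc h1 h2
    by_contra! hcon
    have := hR₂.pos_of_no_root Q (b := c') hQc fun e h1 h2 h3 =>
      hcon e (hconv e h1 h2) (by rw [hP, h3]; simp)
    linarith
  · obtain ⟨y, h1, h2⟩ := h.exists_pos hR₁ hR₂ hS P Q hd' hroot hx (hdx x hx) hP
    exact ⟨y, h1, by rw [sign_pos hP, sign_pos h2]⟩

lemma signMatch_insert {S : Set (R₁[X] × R₂[X])} {P : R₁[X]} {Q : R₂[X]} {x : R₁} {y : R₂} :
    SignMatch (insert (P, Q) S) x y ↔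
      SignType.sign (P.eval x) = SignType.sign (Q.eval y) ∧ SignMatch S x y := by
  simp [SignMatch]

lemma SameSigns.insert_of_forall {S : Set (R₁[X] × R₂[X])} (h : SameSigns S) (P : R₁[X])
    (Q : R₂[X]) (hPQ : ∀ x y, SignMatch S x y →
      SignType.sign (P.eval x) = SignType.sign (Q.eval y)) :
    SameSigns (insert (P, Q) S) := by
  have key : ∀ x y, SignMatch (insert (P, Q) S) x y ↔ SignMatch S x y := fun x y => by
    rw [signMatch_insert]
    exact ⟨fun h => h.2, fun h => ⟨hPQ x y h, h⟩⟩
  constructor <;> simp only [key]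
  exacts [h.forth, h.back, h.ord]

/-- A pair of polynomials can be added to a family with the same sign diagram if the derivatives
belong to the family and the signs at the roots of the family agree. -/
lemma SameSigns.insert (hR₁ : PolyIVT R₁) (hR₂ : PolyIVT R₂)
    {S : Set (R₁[X] × R₂[X])} (hS : S.Finite) (h : SameSigns S) (P : R₁[X]) (Q : R₂[X])
    (hd : (P.derivative, Q.derivative) ∈ S) (hd0 : P.derivative ≠ 0)
    (hroot : ∀ x y, SignMatch S x y → IsRootOf S x →
      SignType.sign (P.eval x) = SignType.sign (Q.eval y)) :
    SameSigns (insert (P, Q) S) where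
  forth x := by
    obtain ⟨y, h1, h2⟩ := h.exists_sign_eq hR₁ hR₂ hS P Q hd hd0 hroot x
    exact ⟨y, signMatch_insert.2 ⟨h2, h1⟩⟩
  back y := by
    obtain ⟨x, h1, h2⟩ := h.swap.exists_sign_eq hR₂ hR₁ (hS.image _) Q P ⟨_, hd, rfl⟩
      (fun h0 => hd0 (h.fst_eq_zero hd h0))
      (fun y x hyx hy => by
        rw [signMatch_swap] at hyx
        exact (hroot x y hyx ((h.isRootOf_iff hyx).2 hy)).symm) y
    exact ⟨x, signMatch_insert.2 ⟨h2.symm, signMatch_swap.1 h1⟩⟩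
  ord x y x' y' h1 h2 hlt hle := by
    rw [signMatch_insert] at *
    obtain ⟨hs1, h1⟩ := h1
    obtain ⟨hs2, h2⟩ := h2
    have hxy' := h.ord x y x' y' h1 h2 hlt hle
    refine ⟨?_, hxy'⟩
    by_cases hx : IsRootOf S x
    · exact hroot x y' hxy' hx
    have hx'y : SignMatch S x' y := h2.trans' hxy' h1
    have hc1 : ∀ c, x ≤ c → c ≤ x' → SignMatch S c y := fun c hc1 hc2 =>
      h.convex h1 hx'y hc1 hc2
    have hc2 : ∀ c, y' ≤ c → c ≤ y → SignMatch S x c := fun c hc1 hc2 =>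
      signMatch_swap.1 (h.swap.convex (signMatch_swap.2 hxy') (signMatch_swap.2 h1) hc1 hc2)
    rcases hle.eq_or_lt with rfl | hlt2
    · exact hs1
    have hdx : P.derivative.eval x ≠ 0 := fun h0 => hx ⟨_, hd, hd0, h0⟩
    have mono : ∀ {a b : R₁}, P.eval a ≤ P.eval b →
        SignType.sign (P.eval a) ≤ SignType.sign (P.eval b) := fun hab => SignType.sign.monotone hab
    have mono2 : ∀ {a b : R₂}, Q.eval a ≤ Q.eval b →
        SignType.sign (Q.eval a) ≤ SignType.sign (Q.eval b) := fun hab => SignType.sign.monotone hab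
    rcases hdx.lt_or_gt with hneg | hpos
    · have e1 := hR₁.eval_lt_of_derivative_neg P hlt fun c hc hc' => by
        have := (hc1 c hc hc' _ hd).trans (h1 _ hd).symm
        rwa [sign_neg hneg, sign_eq_neg_one_iff] at this
      have e2 := hR₂.eval_lt_of_derivative_neg Q hlt2 fun c hc hc' => by
        have := hc2 c hc hc' _ hd
        rwa [sign_neg hneg, eq_comm, sign_eq_neg_one_iff] at this
      have e3 := mono e1.le
      have e4 := mono2 e2.le
      rw [hs2] at e3
      rw [← hs1] at e4
      exact le_antisymm e4 e3
    · have e1 := hR₁.eval_lt_of_derivative_pos P hlt fun c hc hc' => by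
        have := (hc1 c hc hc' _ hd).trans (h1 _ hd).symm
        rwa [sign_pos hpos, sign_eq_one_iff] at this
      have e2 := hR₂.eval_lt_of_derivative_pos Q hlt2 fun c hc hc' => by
        have := hc2 c hc hc' _ hd
        rwa [sign_pos hpos, eq_comm, sign_eq_one_iff] at this
      have e3 := mono e1.le
      have e4 := mono2 e2.le
      rw [hs2] at e3
      rw [← hs1] at e4
      exact le_antisymm e3 e4

end SignTransfer

section ClosedFamily

variable {D : Type*} [CommRing D]

lemma Polynomial.exists_pseudo_rem (q : D[X]) (hq : 0 < q.natDegree) (p : D[X]) :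
    ∃ (N : ℕ) (a r : D[X]), C q.leadingCoeff ^ N * p = a * q + r ∧ r.natDegree < q.natDegree := by
  induction hn : p.natDegree using Nat.strong_induction_on generalizing p with
  | _ n ih =>
    rcases lt_or_ge p.natDegree q.natDegree with h | h
    · exact ⟨0, 0, p, by simp, h⟩
    · obtain ⟨N, a, r, h1, h2⟩ := ih _ (hn ▸ natDegree_cancelLeads_lt_of_natDegree_le_natDegree h
        (hq.trans_le h))
        (q.cancelLeads p) rfl
      refine ⟨N + 1, a + C q.leadingCoeff ^ N * C p.leadingCoeff * X ^ (p.natDegree - q.natDegree),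
        r, ?_, h2⟩
      rw [cancelLeads, Nat.sub_eq_zero_of_le h] at h1
      linear_combination h1

/-- The pseudo-remainder of `p` on division by `q`. -/
noncomputable def Polynomial.pseudoRem (p q : D[X]) : D[X] :=
  open Classical in
  if hq : 0 < q.natDegree then (q.exists_pseudo_rem hq p).choose_spec.choose_spec.choose else 0

lemma Polynomial.pseudoRem_spec (p q : D[X]) (hq : 0 < q.natDegree) :
    ∃ (N : ℕ) (a : D[X]), C q.leadingCoeff ^ N * p = a * q + pseudoRem p q := by
  rw [pseudoRem, dif_pos hq]
  exact ⟨_, _, (q.exists_pseudo_rem hq p).choose_spec.choose_spec.choose_spec.1⟩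

lemma Polynomial.natDegree_pseudoRem_lt (p q : D[X]) (hq : 0 < q.natDegree) :
    (pseudoRem p q).natDegree < q.natDegree := by
  rw [pseudoRem, dif_pos hq]
  exact (q.exists_pseudo_rem hq p).choose_spec.choose_spec.choose_spec.2

/-- A family of polynomials that is closed under derivatives, removal of leading terms and
pseudo-remainders, as far as polynomials of degree greater than `e` are concerned. -/
def IsSturmClosed (e : ℕ) (T : Finset D[X]) : Prop :=
  ∀ p ∈ T, e < p.natDegree → p.derivative ∈ T ∧ p.eraseLead ∈ T ∧
    ∀ q ∈ T, e < q.natDegree → q.natDegree ≤ p.natDegree → pseudoRem p q ∈ T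

lemma exists_isSturmClosed (e k : ℕ) (T : Finset D[X]) (hT : ∀ p ∈ T, p.natDegree ≤ e + k) :
    ∃ T', T ⊆ T' ∧ IsSturmClosed e T' := by
  classical
  suffices H : ∀ j ≤ k, ∃ T', T ⊆ T' ∧ IsSturmClosed (e + (k - j)) T' by
    simpa using H k le_rfl
  intro j
  induction j with
  | zero =>
    intro _
    exact ⟨T, subset_rfl, fun p hp h => absurd (hT p hp) (not_le.2 (by simpa using h))⟩
  | succ j ih =>
    intro hj
    obtain ⟨T₁, hT₁, hcl⟩ := ih (by omega)
    set e' := e + (k - (j + 1))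
    have hee : e + (k - j) = e' + 1 := by omega
    rw [hee] at hcl
    let N := (T₁.image derivative ∪ T₁.image eraseLead ∪
      (T₁ ×ˢ T₁).image fun pq => pseudoRem pq.1 pq.2).filter fun r => r.natDegree ≤ e'
    have hmem : ∀ p ∈ T₁ ∪ N, e' < p.natDegree → p ∈ T₁ := by
      intro p hp h
      rcases Finset.mem_union.1 hp with hp | hp
      · exact hp
      · exact absurd (Finset.mem_filter.1 hp).2 (not_le.2 h)
    refine ⟨T₁ ∪ N, hT₁.trans Finset.subset_union_left, fun p hp h => ?_⟩
    have hpT := hmem p hp h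
    have hrem : ∀ q ∈ T₁, q.natDegree = e' + 1 → pseudoRem p q ∈ N := fun q hq hqd => by
      refine Finset.mem_filter.2 ⟨?_, ?_⟩
      · exact Finset.mem_union_right _ (Finset.mem_image.2 ⟨(p, q), by simp [hpT, hq], rfl⟩)
      · have := natDegree_pseudoRem_lt p q (by omega)
        omega
    rcases Nat.lt_or_ge (e' + 1) p.natDegree with h2 | h2
    · obtain ⟨h3, h4, h5⟩ := hcl p hpT h2
      refine ⟨Finset.mem_union_left _ h3, Finset.mem_union_left _ h4, fun q hq hq1 hq2 => ?_⟩
      have hqT := hmem q hq hq1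
      rcases Nat.lt_or_ge (e' + 1) q.natDegree with h6 | h6
      · exact Finset.mem_union_left _ (h5 q hqT h6 hq2)
      · exact Finset.mem_union_right _ (hrem q hqT (by omega))
    · refine ⟨Finset.mem_union_right _ (Finset.mem_filter.2 ⟨?_, ?_⟩),
        Finset.mem_union_right _ (Finset.mem_filter.2 ⟨?_, ?_⟩), fun q hq hq1 hq2 => ?_⟩
      · exact Finset.mem_union_left _ (Finset.mem_union_left _ (Finset.mem_image_of_mem _ hpT))
      · have := natDegree_derivative_le p
        omega
      · exact Finset.mem_union_left _ (Finset.mem_union_right _ (Finset.mem_image_of_mem _ hpT))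
      · have := eraseLead_natDegree_le p
        omega
      · exact Finset.mem_union_right _ (hrem q (hmem q hq hq1) (by omega))

lemma map_eraseLead_of_leadingCoeff {R : Type*} [CommRing R] (φ : D →+* R) (p : D[X])
    (h : φ p.leadingCoeff = 0) :
    p.eraseLead.map φ = p.map φ := by
  have := congrArg (Polynomial.map φ) p.eraseLead_add_C_mul_X_pow
  simpa only [Polynomial.map_add, Polynomial.map_mul, map_C, h, C_0, zero_mul, add_zero] using this

variable {R₁ : Type*} [Field R₁] [LinearOrder R₁]

/-- A polynomial of a closed family can be replaced by one of the family with the same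
specialization whose leading coefficient does not specialize to zero. -/
lemma IsSturmClosed.exists_leadingCoeff_ne_zero {T : Finset D[X]} (hT : IsSturmClosed 0 T)
    (φ : D →+* R₁) {x : R₁} :
    ∀ (n : ℕ) (q : D[X]), q ∈ T → q.natDegree = n → q.map φ ≠ 0 → (q.map φ).eval x = 0 →
      ∃ q' ∈ T, q'.natDegree ≤ n ∧ 0 < q'.natDegree ∧ φ q'.leadingCoeff ≠ 0 ∧
        q'.map φ = q.map φ := by
  intro n
  induction n using Nat.strong_induction_on with
  | _ n ih =>
    intro q hq hqn hq0 hqx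
    rcases Nat.eq_zero_or_pos q.natDegree with h | h
    · rw [eq_C_of_natDegree_eq_zero h] at hq0 hqx
      simp only [map_C, eval_C] at hqx
      rw [map_C, hqx, C_0] at hq0
      exact absurd rfl hq0
    · by_cases hl : φ q.leadingCoeff = 0
      · have hmap := map_eraseLead_of_leadingCoeff φ q hl
        have hlt := eraseLead_natDegree_le q
        obtain ⟨q', h1, h2, h3, h4, h5⟩ := ih _ (by omega) q.eraseLead (hT q hq h).2.1 rfl
          (by rwa [hmap]) (by rwa [hmap])
        exact ⟨q', h1, by omega, h3, h4, h5.trans hmap⟩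
      · exact ⟨q, hq, hqn.le, h, hl, rfl⟩

variable [IsStrictOrderedRing R₁]
  {R₂ : Type*} [Field R₂] [LinearOrder R₂] [IsStrictOrderedRing R₂]

/-- Specializations of a closed family whose coefficients have the same signs have the same
sign diagram. -/
theorem IsSturmClosed.sameSigns (hR₁ : PolyIVT R₁) (hR₂ : PolyIVT R₂) (φ₁ : D →+* R₁)
    (φ₂ : D →+* R₂) (n : ℕ) :
    ∀ T : Finset D[X], T.card = n → IsSturmClosed 0 T →
      (∀ p ∈ T, ∀ i, SignType.sign (φ₁ (p.coeff i)) = SignType.sign (φ₂ (p.coeff i))) →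
      SameSigns ((fun p : D[X] => (p.map φ₁, p.map φ₂)) '' (T : Set D[X])) := by
  classical
  induction n with
  | zero =>
    intro T hT _ _
    rw [Finset.card_eq_zero] at hT
    subst hT
    constructor <;> simp [SignMatch]
  | succ n ih =>
    intro T hn hT hc
    obtain ⟨p, hp, hmax⟩ := T.exists_max_image natDegree (Finset.card_pos.1 (by omega))
    have herase : ∀ r ∈ T, 0 < p.natDegree → r.natDegree < p.natDegree → r ∈ T.erase p :=
      fun r hr _ hlt => Finset.mem_erase.2 ⟨by rintro rfl; exact lt_irrefl _ hlt, hr⟩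
    have hT' : IsSturmClosed 0 (T.erase p) := by
      intro q hq hq0
      have hqT := Finset.mem_of_mem_erase hq
      obtain ⟨h1, h2, h3⟩ := hT q hqT hq0
      have hqp := hmax q hqT
      refine ⟨herase _ h1 (by omega) ?_, herase _ h2 (by omega) ?_, fun r hr hr0 hrq => ?_⟩
      · have := natDegree_derivative_le q
        omega
      · have := eraseLead_natDegree_le q
        omega
      · refine herase _ (h3 r (Finset.mem_of_mem_erase hr) hr0 hrq) (by omega) ?_
        have := natDegree_pseudoRem_lt q r hr0
        omega
    have key := ih (T.erase p) (by rw [Finset.card_erase_of_mem hp, hn]; rfl) hT'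
      (fun q hq => hc q (Finset.mem_of_mem_erase hq))
    rw [← Finset.insert_erase hp, Finset.coe_insert, Set.image_insert_eq]
    have mem : ∀ r ∈ T.erase p, (r.map φ₁, r.map φ₂) ∈
        (fun p : D[X] => (p.map φ₁, p.map φ₂)) '' (T.erase p : Set D[X]) :=
      fun r hr => ⟨r, hr, rfl⟩
    rcases Nat.eq_zero_or_pos p.natDegree with h0 | h0
    · refine key.insert_of_forall _ _ fun x y _ => ?_
      rw [eq_C_of_natDegree_eq_zero h0]
      simpa using hc p hp 0
    obtain ⟨hder, hlead, hrem⟩ := hT p hp h0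
    by_cases hl : φ₁ p.leadingCoeff = 0
    · have hl2 : φ₂ p.leadingCoeff = 0 := by
        have := hc p hp p.natDegree
        rwa [coeff_natDegree, hl, sign_zero, eq_comm, sign_eq_zero_iff] at this
      refine key.insert_of_forall _ _ fun x y hxy => ?_
      rw [← map_eraseLead_of_leadingCoeff φ₁ p hl, ← map_eraseLead_of_leadingCoeff φ₂ p hl2]
      exact hxy _ (mem _ (herase _ hlead h0 (by have := eraseLead_natDegree_le p; omega)))
    · refine key.insert hR₁ hR₂ ((Finset.finite_toSet _).image _) _ _ ?_ ?_ ?_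
      · rw [derivative_map, derivative_map]
        exact mem _ (herase _ hder h0 (by have := natDegree_derivative_le p; omega))
      · rw [derivative_ne_zero, natDegree_map_of_leadingCoeff_ne_zero _ hl]
        exact h0.ne'
      · rintro x y hxy ⟨_, ⟨q, hq, rfl⟩, hq0, hqx⟩
        obtain ⟨q', hq', -, hq'0, hq'l, hq'map⟩ :=
          hT'.exists_leadingCoeff_ne_zero φ₁ (x := x) _ q hq rfl hq0 hqx
        have hq'T := Finset.mem_of_mem_erase hq'
        obtain ⟨N, a, hdiv⟩ := pseudoRem_spec p q' hq'0
        have hrT := herase _ (hrem q' hq'T hq'0 (hmax q' hq'T)) h0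
          ((natDegree_pseudoRem_lt p q' hq'0).trans_le (hmax q' hq'T))
        have hx0 : (q'.map φ₁).eval x = 0 := by rw [hq'map]; exact hqx
        have hy0 : (q'.map φ₂).eval y = 0 := by
          have := hxy _ (mem q' hq')
          simp only at this
          rwa [hx0, sign_zero, eq_comm, sign_eq_zero_iff] at this
        have hlc : SignType.sign (φ₁ q'.leadingCoeff) = SignType.sign (φ₂ q'.leadingCoeff) :=
          hc q' hq'T q'.natDegree
        have e1 := congrArg (fun r => (r.map φ₁).eval x) hdiv
        have e2 := congrArg (fun r => (r.map φ₂).eval y) hdiv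
        simp only [Polynomial.map_mul, Polynomial.map_add, Polynomial.map_pow, map_C, eval_mul,
          eval_add, eval_pow, eval_C, hx0, hy0, mul_zero, zero_add] at e1 e2
        have hr := hxy _ (mem _ hrT)
        simp only at hr
        rw [← e1, ← e2, sign_mul, sign_mul, sign_pow, sign_pow, hlc] at hr
        refine mul_left_cancel₀ (pow_ne_zero N ?_) hr
        rw [← hlc]
        exact sign_ne_zero.2 hq'l

end ClosedFamily

/-- Transfer of sign conditions on finitely many polynomials to a field with the intermediate
value property. -/
theorem exists_algHom_sign_eq {R₁ : Type*} [Field R₁] [LinearOrder R₁] [IsStrictOrderedRing R₁]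
    (hR₁ : PolyIVT R₁) (hR₂ : PolyIVT ℝ) (n : ℕ) :
    ∀ (φ : MvPolynomial (Fin n) ℝ →+* R₁) (T : Finset (MvPolynomial (Fin n) ℝ)),
      ∃ ψ : MvPolynomial (Fin n) ℝ →ₐ[ℝ] ℝ, ∀ p ∈ T,
        SignType.sign (φ p) = SignType.sign (ψ p) := by
  classical
  induction n with
  | zero =>
    intro φ T
    refine ⟨MvPolynomial.aeval 0, fun p _ => ?_⟩
    obtain ⟨c, rfl⟩ := MvPolynomial.C_surjective (Fin 0) p
    simp only [MvPolynomial.algHom_C, Algebra.algebraMap_self, RingHom.id_apply]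
    have hpos : ∀ c : ℝ, 0 < c → 0 < φ (MvPolynomial.C c) := fun c hc => by
      have h1 : φ (MvPolynomial.C c) = φ (MvPolynomial.C (Real.sqrt c)) ^ 2 := by
        rw [← map_pow, ← map_pow, Real.sq_sqrt hc.le]
      have h2 : φ (MvPolynomial.C c) ≠ 0 := by
        rw [← RingHom.comp_apply]
        exact (_root_.map_ne_zero _).2 hc.ne'
      exact lt_of_le_of_ne (h1 ▸ sq_nonneg _) h2.symm
    rcases lt_trichotomy c 0 with h | rfl | h
    · have := hpos (-c) (by linarith)
      rw [map_neg, map_neg] at this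
      rw [sign_neg h, sign_neg (by linarith)]
    · simp
    · rw [sign_pos h, sign_pos (hpos c h)]
  | succ n ih =>
    intro φ T
    let E := MvPolynomial.finSuccEquiv ℝ n
    let φ' : (MvPolynomial (Fin n) ℝ)[X] →+* R₁ := φ.comp E.symm.toRingEquiv.toRingHom
    let φ₁ : MvPolynomial (Fin n) ℝ →+* R₁ := φ'.comp C
    have hφ' : ∀ q, φ' q = (q.map φ₁).eval (φ' X) := fun q => by
      rw [eval_map, ← coe_eval₂RingHom]
      congr 1
      refine Polynomial.ringHom_ext' ?_ ?_
      · ext <;> simp [φ₁]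
      · simp
    obtain ⟨T', hTT', hT'⟩ := exists_isSturmClosed 0 ((T.image E).sup natDegree) (T.image E)
      (fun p hp => by simpa using Finset.le_sup (f := natDegree) hp)
    obtain ⟨ψ', hψ'⟩ := ih φ₁ (T'.biUnion fun p => (Finset.range (p.natDegree + 1)).image p.coeff)
    have hsame := hT'.sameSigns hR₁ hR₂ φ₁ ψ'.toRingHom _ T' rfl fun p hp i => by
      rcases Nat.lt_or_ge p.natDegree i with h | h
      · simp [coeff_eq_zero_of_natDegree_lt h]
      · exact hψ' _ (Finset.mem_biUnion.2 ⟨p, hp, Finset.mem_image.2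
          ⟨i, Finset.mem_range.2 (by omega), rfl⟩⟩)
    obtain ⟨y, hy⟩ := hsame.forth (φ' X)
    refine ⟨(Polynomial.eval₂AlgHom ψ' y fun _ => mul_comm _ _).comp E.toAlgHom, fun p hp => ?_⟩
    have h1 := hy _ ⟨E p, hTT' (Finset.mem_image_of_mem _ hp), rfl⟩
    simp only at h1
    rw [← hφ'] at h1
    have h2 : φ' (E p) = φ p := by simp [φ']
    rw [h2, eval_map] at h1
    exact h1

section PrimeCone

variable {A : Type*} [CommRing A]

/-- A subsemiring is a prime cone if it is a total, proper positive cone with prime support. -/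
structure IsPrimeCone (Q : Subsemiring A) : Prop where
  neg_one_notMem : -1 ∉ Q
  total : ∀ a, a ∈ Q ∨ -a ∈ Q
  prime : ∀ a b, a * b ∈ Q → -(a * b) ∈ Q → (a ∈ Q ∧ -a ∈ Q) ∨ (b ∈ Q ∧ -b ∈ Q)

/-- The subsemiring `P + a P` obtained by adjoining an element to a preordering. -/
def Subsemiring.adjoinElement (P : Subsemiring A) (hP : ∀ a, a * a ∈ P) (a : A) :
    Subsemiring A where
  carrier := {z | ∃ x ∈ P, ∃ y ∈ P, z = x + a * y}
  mul_mem' := by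
    rintro _ _ ⟨x, hx, y, hy, rfl⟩ ⟨u, hu, v, hv, rfl⟩
    exact ⟨x * u + a * a * (y * v), add_mem (mul_mem hx hu) (mul_mem (hP a) (mul_mem hy hv)),
      x * v + y * u, add_mem (mul_mem hx hv) (mul_mem hy hu), by ring⟩
  one_mem' := ⟨1, one_mem P, 0, zero_mem P, by ring⟩
  add_mem' := by
    rintro _ _ ⟨x, hx, y, hy, rfl⟩ ⟨u, hu, v, hv, rfl⟩
    exact ⟨x + u, add_mem hx hu, y + v, add_mem hy hv, by ring⟩
  zero_mem' := ⟨0, zero_mem P, 0, zero_mem P, by ring⟩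

lemma Subsemiring.le_adjoinElement (P : Subsemiring A) (hP : ∀ a, a * a ∈ P) (a : A) :
    P ≤ P.adjoinElement hP a :=
  fun x hx => ⟨x, hx, 0, zero_mem P, by ring⟩

lemma Subsemiring.self_mem_adjoinElement (P : Subsemiring A) (hP : ∀ a, a * a ∈ P) (a : A) :
    a ∈ P.adjoinElement hP a :=
  ⟨0, zero_mem P, 1, one_mem P, by ring⟩

/-- Every proper preordering is contained in a prime cone. -/
theorem exists_isPrimeCone (P : Subsemiring A) (hP : ∀ a, a * a ∈ P) (h1 : -1 ∉ P) :
    ∃ Q, P ≤ Q ∧ IsPrimeCone Q := by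
  obtain ⟨Q, hPQ, hQ⟩ := zorn_le_nonempty₀ {Q : Subsemiring A | P ≤ Q ∧ -1 ∉ Q}
    (fun c hc hchain y hy => by
      refine ⟨sSup c, ⟨(hc hy).1.trans (le_sSup hy), fun h => ?_⟩, fun z hz => le_sSup hz⟩
      obtain ⟨Q, hQ, h⟩ := (Subsemiring.mem_sSup_of_directedOn ⟨y, hy⟩ hchain.directedOn).1 h
      exact (hc hQ).2 h) P ⟨le_rfl, h1⟩
  have hsq : ∀ a, a * a ∈ Q := fun a => hPQ (hP a)
  have hn1 : -1 ∉ Q := hQ.prop.2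
  have key : ∀ a, a ∉ Q → ∃ x ∈ Q, ∃ y ∈ Q, -1 = x + a * y := fun a ha => by
    by_contra hcon
    have := hQ.le_of_ge (y := Q.adjoinElement hsq a)
      ⟨hPQ.trans (Q.le_adjoinElement hsq a), hcon⟩ (Q.le_adjoinElement hsq a)
    exact ha (this (Q.self_mem_adjoinElement hsq a))
  have total : ∀ a, a ∈ Q ∨ -a ∈ Q := fun a => by
    by_contra! hcon
    obtain ⟨x, hx, y, hy, h1⟩ := key a hcon.1
    obtain ⟨u, hu, v, hv, h2⟩ := key (-a) hcon.2
    apply hn1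
    have : -1 = x + u + x * u + a * a * (y * v) := by
      linear_combination (1 + u) * h1 - a * y * h2
    rw [this]
    exact add_mem (add_mem (add_mem hx hu) (mul_mem hx hu)) (mul_mem (hsq a) (mul_mem hy hv))
  have main : ∀ a b, -a ∉ Q → -b ∉ Q → -(a * b) ∉ Q := fun a b ha hb hab => by
    obtain ⟨x, hx, y, hy, h1⟩ := key _ ha
    obtain ⟨u, hu, v, hv, h2⟩ := key _ hb
    apply hn1
    have : -1 = x + u + x * u + -(a * b) * (y * v) := by
      linear_combination (1 + u) * h1 + a * y * h2
    rw [this]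
    exact add_mem (add_mem (add_mem hx hu) (mul_mem hx hu)) (mul_mem hab (mul_mem hy hv))
  refine ⟨Q, hPQ, hn1, total, fun a b h1 h2 => ?_⟩
  by_contra! hcon
  obtain ⟨ha, hb⟩ := hcon
  rcases total a with ha' | ha' <;> rcases total b with hb' | hb'
  · exact main a b (ha ha') (hb hb') h2
  · have hb2 : b ∉ Q := fun h => hb h hb'
    exact main a (-b) (ha ha') (by simpa using hb2) (by simpa using h1)
  · have ha2 : a ∉ Q := fun h => ha h ha'
    exact main (-a) b (by simpa using ha2) (hb hb') (by simpa using h1)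
  · have ha2 : a ∉ Q := fun h => ha h ha'
    have hb2 : b ∉ Q := fun h => hb h hb'
    exact main (-a) (-b) (by simpa using ha2) (by simpa using hb2) (by simpa using h2)

/-- The support of a prime cone. -/
def IsPrimeCone.support {Q : Subsemiring A} (hQ : IsPrimeCone Q) : Ideal A where
  carrier := {a | a ∈ Q ∧ -a ∈ Q}
  add_mem' := fun {a b} ha hb => ⟨add_mem ha.1 hb.1, by
    rw [neg_add]; exact add_mem ha.2 hb.2⟩
  zero_mem' := ⟨zero_mem Q, by simp⟩
  smul_mem' := fun c a ha => by
    simp only [smul_eq_mul, Set.mem_ofPred_eq]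
    rcases hQ.total c with hc | hc
    · exact ⟨mul_mem hc ha.1, by rw [← mul_neg]; exact mul_mem hc ha.2⟩
    · exact ⟨by rw [← neg_mul_neg]; exact mul_mem hc ha.2, by rw [← neg_mul]; exact mul_mem hc ha.1⟩

lemma IsPrimeCone.mem_support {Q : Subsemiring A} (hQ : IsPrimeCone Q) {a : A} :
    a ∈ hQ.support ↔ a ∈ Q ∧ -a ∈ Q := Iff.rfl

lemma IsPrimeCone.isPrime_support {Q : Subsemiring A} (hQ : IsPrimeCone Q) :
    hQ.support.IsPrime where
  ne_top' := by
    rw [Ne, Ideal.eq_top_iff_one, hQ.mem_support]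
    exact fun h => hQ.neg_one_notMem h.2
  mem_or_mem' := fun {a b} h => hQ.prime a b h.1 h.2

variable {F : Type*} [Field F]

/-- The positive cone of an ordering of a subfield of `F`. -/
structure IsSubfieldCone (T : Subsemiring F) : Prop where
  inv_mem : ∀ a ∈ T, a⁻¹ ∈ T
  neg_one_notMem : -1 ∉ T
  sub_mem : ∀ a ∈ T, ∀ b ∈ T, a - b ∈ T ∨ b - a ∈ T

/-- A prime cone induces a cone of fractions in any field containing its residue domain. -/
theorem IsPrimeCone.exists_isSubfieldCone {Q : Subsemiring A} (hQ : IsPrimeCone Q) (φ : A →+* F)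
    (hφ : ∀ a, φ a = 0 ↔ a ∈ hQ.support) : ∃ T, IsSubfieldCone T ∧ ∀ a ∈ Q, φ a ∈ T := by
  let T : Subsemiring F :=
    { carrier := {z | ∃ a ∈ Q, ∃ b ∈ Q, φ b ≠ 0 ∧ z = φ a / φ b}
      mul_mem' := by
        rintro _ _ ⟨a, ha, b, hb, hb0, rfl⟩ ⟨c, hc, d, hd, hd0, rfl⟩
        refine ⟨a * c, mul_mem ha hc, b * d, mul_mem hb hd, by simp [hb0, hd0], ?_⟩
        rw [map_mul, map_mul, div_mul_div_comm]
      one_mem' := ⟨1, one_mem Q, 1, one_mem Q, by simp, by simp⟩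
      add_mem' := by
        rintro _ _ ⟨a, ha, b, hb, hb0, rfl⟩ ⟨c, hc, d, hd, hd0, rfl⟩
        refine ⟨a * d + b * c, add_mem (mul_mem ha hd) (mul_mem hb hc), b * d, mul_mem hb hd,
          by simp [hb0, hd0], ?_⟩
        rw [map_mul, map_add, map_mul, map_mul, div_add_div _ _ hb0 hd0]
      zero_mem' := ⟨0, zero_mem Q, 1, one_mem Q, by simp, by simp⟩ }
  refine ⟨T, ⟨?_, ?_, ?_⟩, fun a ha => ⟨a, ha, 1, one_mem Q, by simp, by simp⟩⟩
  · rintro _ ⟨a, ha, b, hb, hb0, rfl⟩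
    by_cases h : φ a = 0
    · rw [h, zero_div, inv_zero]
      exact zero_mem T
    · exact ⟨b, hb, a, ha, h, inv_div _ _⟩
  · rintro ⟨a, ha, b, hb, hb0, h⟩
    rw [eq_div_iff hb0] at h
    have h2 := ((hφ (a + b)).1 (by rw [map_add, ← h]; ring)).2
    refine hb0 ((hφ b).2 ⟨hb, ?_⟩)
    have := add_mem h2 ha
    rwa [neg_add_rev, neg_add_cancel_right] at this
  · rintro _ ⟨a, ha, b, hb, hb0, rfl⟩ _ ⟨c, hc, d, hd, hd0, rfl⟩
    rw [div_sub_div _ _ hb0 hd0, div_sub_div _ _ hd0 hb0]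
    rcases hQ.total (a * d - b * c) with h | h
    · exact Or.inl ⟨_, h, b * d, mul_mem hb hd, by simp [hb0, hd0], by simp⟩
    · exact Or.inr ⟨_, h, d * b, mul_mem hd hb, by simp [hb0, hd0], by
        simp only [map_neg, map_sub, map_mul]; ring⟩

end PrimeCone

namespace IsSubfieldCone

variable {F : Type*} [Field F] {T : Subsemiring F}

lemma eq_zero_of_neg_mem (hT : IsSubfieldCone T) {x : F} (h1 : x ∈ T) (h2 : -x ∈ T) : x = 0 := by
  by_contra h
  refine hT.neg_one_notMem ?_
  have := mul_mem h2 (hT.inv_mem x h1)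
  rwa [neg_mul, mul_inv_cancel₀ h] at this

/-- The subfield ordered by a subfield cone. -/
def subfield (hT : IsSubfieldCone T) : Subfield F where
  carrier := {x | x ∈ T ∨ -x ∈ T}
  mul_mem' := by
    rintro a b (ha | ha) (hb | hb)
    · exact Or.inl (mul_mem ha hb)
    · exact Or.inr (by rw [← mul_neg]; exact mul_mem ha hb)
    · exact Or.inr (by rw [← neg_mul]; exact mul_mem ha hb)
    · exact Or.inl (by rw [← neg_mul_neg]; exact mul_mem ha hb)
  one_mem' := Or.inl (one_mem T)
  add_mem' := by
    rintro a b (ha | ha) (hb | hb)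
    · exact Or.inl (add_mem ha hb)
    · simpa [sub_eq_add_neg, add_comm] using hT.sub_mem a ha (-b) hb
    · simpa [sub_eq_add_neg, add_comm] using hT.sub_mem b hb (-a) ha
    · exact Or.inr (by rw [neg_add]; exact add_mem ha hb)
  zero_mem' := Or.inl (zero_mem T)
  neg_mem' := by
    rintro a (ha | ha)
    · exact Or.inr (by rwa [neg_neg])
    · exact Or.inl ha
  inv_mem' := by
    rintro a (ha | ha)
    · exact Or.inl (hT.inv_mem a ha)
    · exact Or.inr (by rw [← inv_neg]; exact hT.inv_mem _ ha)

lemma mem_subfield (hT : IsSubfieldCone T) {x : F} : x ∈ hT.subfield ↔ x ∈ T ∨ -x ∈ T := Iff.rfl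

/-- The linear order on the subfield of a subfield cone. -/
@[reducible]
noncomputable def linearOrder (hT : IsSubfieldCone T) : LinearOrder hT.subfield where
  le a b := (b : F) - a ∈ T
  le_refl a := by simp
  le_trans a b c h1 h2 := by
    have := add_mem h2 h1
    rwa [sub_add_sub_cancel] at this
  le_antisymm a b h1 h2 :=
    Subtype.ext (sub_eq_zero.1 (hT.eq_zero_of_neg_mem h1 (by rwa [neg_sub]))).symm
  le_total a b := by
    have := hT.mem_subfield.1 (b - a).2
    simpa using this
  toDecidableLE := Classical.decRel _

lemma isStrictOrderedRing (hT : IsSubfieldCone T) :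
    let _ := hT.linearOrder
    IsStrictOrderedRing hT.subfield := by
  let _ := hT.linearOrder
  have nonneg : ∀ a : hT.subfield, 0 ≤ a ↔ (a : F) ∈ T := fun a => by
    change (a : F) - ((0 : hT.subfield) : F) ∈ T ↔ _
    simp
  have le_iff : ∀ a b : hT.subfield, a ≤ b ↔ (b : F) - a ∈ T := fun _ _ => Iff.rfl
  have : IsOrderedAddMonoid hT.subfield :=
    ⟨fun a b h c => by rw [le_iff] at *; simpa using h,
      fun a b h c => by rw [le_iff] at *; simpa using h⟩
  have : ZeroLEOneClass hT.subfield := ⟨(nonneg 1).2 (one_mem T)⟩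
  have : IsOrderedRing hT.subfield := .of_mul_nonneg fun a b ha hb => by
    rw [nonneg] at *
    exact mul_mem ha hb
  exact IsOrderedRing.toIsStrictOrderedRing _

lemma nonneg_iff (hT : IsSubfieldCone T) (a : hT.subfield) :
    let _ := hT.linearOrder
    0 ≤ a ↔ (a : F) ∈ T := by
  let _ := hT.linearOrder
  change (a : F) - ((0 : hT.subfield) : F) ∈ T ↔ _
  simp

/-- Every subfield cone is contained in a maximal one. -/
lemma exists_maximal (hT : IsSubfieldCone T) :
    ∃ T', T ≤ T' ∧ Maximal (fun T' : Subsemiring F => IsSubfieldCone T') T' := by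
  refine zorn_le_nonempty₀ {T' : Subsemiring F | IsSubfieldCone T'}
    (fun c hc hchain y hy => ?_) T hT
  have hmem : ∀ {x}, x ∈ sSup c ↔ ∃ s ∈ c, x ∈ s := fun {x} =>
    Subsemiring.mem_sSup_of_directedOn ⟨y, hy⟩ hchain.directedOn
  refine ⟨sSup c, ⟨fun a ha => ?_, fun h => ?_, fun a ha b hb => ?_⟩, fun z hz => le_sSup hz⟩
  · obtain ⟨s, hs, h⟩ := hmem.1 ha
    exact hmem.2 ⟨s, hs, (hc hs).inv_mem a h⟩
  · obtain ⟨s, hs, h⟩ := hmem.1 h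
    exact (hc hs).neg_one_notMem h
  · obtain ⟨s, hs, h⟩ := hmem.1 ha
    obtain ⟨t, ht, h'⟩ := hmem.1 hb
    obtain ⟨u, hu, hsu, htu⟩ := hchain.directedOn s hs t ht
    exact ((hc hu).sub_mem a (hsu h) b (htu h')).imp (fun h => hmem.2 ⟨u, hu, h⟩)
      fun h => hmem.2 ⟨u, hu, h⟩

end IsSubfieldCone

section SignChange

variable {R : Type*} [Field R] [LinearOrder R] [IsStrictOrderedRing R]

variable (R) in
/-- The multiplicative monoid of nonnegative multiples of squares of polynomials. -/
def nonnegSquares : Submonoid R[X] where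
  carrier := {z | ∃ c : R, 0 ≤ c ∧ ∃ f : R[X], z = C c * f ^ 2}
  mul_mem' := by
    rintro _ _ ⟨c, hc, f, rfl⟩ ⟨d, hd, g, rfl⟩
    exact ⟨c * d, mul_nonneg hc hd, f * g, by rw [C_mul]; ring⟩
  one_mem' := ⟨1, zero_le_one, 1, by simp⟩

/-- Weighted sums of squares can be reduced modulo a polynomial. -/
lemma exists_reduce_mod (p : R[X]) (hp : 0 < p.natDegree) {s : R[X]}
    (hs : s ∈ (nonnegSquares R).subsemiringClosure) :
    ∃ s' ∈ (nonnegSquares R).subsemiringClosure, p ∣ s - s' ∧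
      s'.natDegree ≤ 2 * (p.natDegree - 1) ∧ ∀ x, 0 ≤ s'.eval x := by
  rw [← SetLike.mem_coe, Submonoid.subsemiringClosure_coe, SetLike.mem_coe] at hs
  induction hs using AddSubmonoid.closure_induction with
  | mem z hz =>
    obtain ⟨c, hc, f, rfl⟩ := hz
    refine ⟨C c * (f % p) ^ 2, AddSubmonoid.subset_closure ⟨c, hc, _, rfl⟩, ?_, ?_, fun x => ?_⟩
    · rw [← mul_sub, sq_sub_sq]
      refine dvd_mul_of_dvd_right (dvd_mul_of_dvd_right ?_ _) _
      exact ⟨f / p, by rw [sub_eq_iff_eq_add]; exact (EuclideanDomain.div_add_mod f p).symm⟩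
    · refine natDegree_C_mul_le _ _ |>.trans (natDegree_pow_le.trans ?_)
      have := natDegree_mod_lt f hp.ne'
      omega
    · simpa using mul_nonneg hc (sq_nonneg _)
  | zero => exact ⟨0, zero_mem _, by simp, by simp, by simp⟩
  | add y z _ _ ihy ihz =>
    obtain ⟨y', h1, h2, h3, h4⟩ := ihy
    obtain ⟨z', h5, h6, h7, h8⟩ := ihz
    refine ⟨y' + z', add_mem h1 h5, ?_, natDegree_add_le_of_degree_le h3 h7, fun x => ?_⟩
    · rw [add_sub_add_comm]
      exact dvd_add h2 h6
    · rw [eval_add]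
      exact add_nonneg (h4 x) (h8 x)

/-- A polynomial with a change of sign does not generate a proper ideal containing `1 + s` for
a weighted sum of squares `s`. -/
lemma not_dvd_one_add_of_sign_change (n : ℕ) :
    ∀ (p : R[X]), p.natDegree = n → ∀ (a b : R), p.eval a * p.eval b < 0 →
      ∀ s ∈ (nonnegSquares R).subsemiringClosure, ¬ p ∣ 1 + s := by
  induction n using Nat.strong_induction_on with
  | _ n ih =>
    intro p hn a b hab s hs hdvd
    have hp : 0 < p.natDegree := by
      by_contra h
      rw [eq_C_of_natDegree_eq_zero (by omega : p.natDegree = 0)] at hab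
      simp only [eval_C] at hab
      exact absurd hab (not_lt.2 (mul_self_nonneg _))
    obtain ⟨s', hs', h1, h2, h3⟩ := exists_reduce_mod p hp hs
    obtain ⟨h, hh⟩ : p ∣ 1 + s' := by
      have := dvd_sub hdvd h1
      rwa [add_sub_assoc, sub_sub_cancel] at this
    have hpos : ∀ x, 0 < p.eval x * h.eval x := fun x => by
      rw [← eval_mul, ← hh, eval_add, eval_one]
      linarith [h3 x]
    have hp0 : p ≠ 0 := by rintro rfl; simp at hp
    have hh0 : h ≠ 0 := by rintro rfl; simpa using hpos 0
    have hdeg : (p * h).natDegree ≤ 2 * (p.natDegree - 1) := by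
      rw [← hh]
      exact natDegree_add_le_of_degree_le (by simp) h2
    rw [natDegree_mul hp0 hh0] at hdeg
    refine ih h.natDegree (by omega) h rfl a b ?_ s' hs' ⟨p, by rw [hh, mul_comm]⟩
    have := mul_pos (hpos a) (hpos b)
    by_contra hcon
    nlinarith [mul_nonneg (not_lt.1 hcon) (neg_nonneg.2 hab.le)]

/-- A polynomial with a change of sign has an irreducible factor with a change of sign, so it
suffices to find roots of irreducible polynomials. -/
lemma polyIVT_of_irreducible (H : ∀ (p : R[X]) (a b : R), Irreducible p → a < b →
    p.eval a * p.eval b < 0 → ∃ c, a < c ∧ c < b ∧ p.eval c = 0) : PolyIVT R := by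
  intro p a b hab
  induction p using WfDvdMonoid.induction_on_irreducible with
  | zero => simp
  | unit u hu =>
    obtain ⟨c, -, rfl⟩ := Polynomial.isUnit_iff.1 hu
    intro h
    simp only [eval_C] at h
    exact absurd h (not_lt.2 (mul_self_nonneg _))
  | mul q i hq hi ih =>
    intro h
    rw [eval_mul, eval_mul, mul_mul_mul_comm] at h
    rcases mul_neg_iff.1 h with ⟨-, h⟩ | ⟨h, -⟩
    · obtain ⟨c, h1, h2, h3⟩ := ih h
      exact ⟨c, h1, h2, by rw [eval_mul, h3, mul_zero]⟩
    · obtain ⟨c, h1, h2, h3⟩ := H i a b hi hab h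
      exact ⟨c, h1, h2, by rw [eval_mul, h3, zero_mul]⟩

end SignChange

/-- The preordering of a polynomial ring obtained from weighted sums of squares and multiples of a
given polynomial. -/
def nonnegSquaresModulo {R : Type*} [Field R] [LinearOrder R] [IsStrictOrderedRing R] (p : R[X]) :
    Subsemiring R[X] where
  carrier := {z | ∃ s ∈ (nonnegSquares R).subsemiringClosure, p ∣ z - s}
  mul_mem' := by
    rintro z w ⟨s, hs, h⟩ ⟨t, ht, k⟩
    refine ⟨s * t, mul_mem hs ht, ?_⟩
    have : z * w - s * t = (z - s) * w + s * (w - t) := by ring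
    rw [this]
    exact dvd_add (dvd_mul_of_dvd_left h _) (dvd_mul_of_dvd_right k _)
  one_mem' := ⟨1, one_mem _, by simp⟩
  add_mem' := by
    rintro z w ⟨s, hs, h⟩ ⟨t, ht, k⟩
    exact ⟨s + t, add_mem hs ht, by rw [add_sub_add_comm]; exact dvd_add h k⟩
  zero_mem' := ⟨0, zero_mem _, by simp⟩

namespace IsSubfieldCone

universe u

variable {F : Type u} [Field F] [IsAlgClosed F] {T : Subsemiring F}

/-- A maximal subfield cone of an algebraically closed field has the intermediate value property
for polynomials. -/
theorem polyIVT_of_maximal (hT : IsSubfieldCone T)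
    (hmax : Maximal (fun T' : Subsemiring F => IsSubfieldCone T') T) :
    let _ := hT.linearOrder
    let _ := hT.isStrictOrderedRing
    PolyIVT hT.subfield := by
  intro _ _
  refine polyIVT_of_irreducible fun p a b hp hab hsign => ?_
  have hsub : ∀ s ∈ (nonnegSquares hT.subfield).subsemiringClosure, s ∈ nonnegSquaresModulo p :=
    fun s hs => ⟨s, hs, by simp⟩
  obtain ⟨Q, hPQ, hQ⟩ := exists_isPrimeCone (nonnegSquaresModulo p)
    (fun f => hsub _ (AddSubmonoid.subset_closure ⟨1, zero_le_one, f, by simp [sq]⟩)) (by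
      rintro ⟨s, hs, h⟩
      refine not_dvd_one_add_of_sign_change _ p rfl a b hsign s hs ?_
      rw [← dvd_neg, neg_add']
      exact h)
  have hpQ : p ∈ hQ.support :=
    ⟨hPQ ⟨0, zero_mem _, by simp⟩, hPQ ⟨0, zero_mem _, by simp⟩⟩
  obtain ⟨θ, hθ⟩ :=
    IsAlgClosed.exists_aeval_eq_zero F p (natDegree_pos_iff_degree_pos.1 hp.natDegree_pos).ne'
  have hker : ∀ (I : Ideal hT.subfield[X]), I ≠ ⊤ → p ∈ I → ∀ q, q ∈ I ↔ p ∣ q := by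
    refine fun I hI hpI q => ⟨fun hq => ?_, fun h => I.mem_of_dvd h hpI⟩
    by_contra hcon
    obtain ⟨u, v, huv⟩ := (hp.coprime_iff_not_dvd.2 hcon)
    refine hI (I.eq_top_iff_one.2 ?_)
    rw [← huv]
    exact I.add_mem (I.mul_mem_left _ hpI) (I.mul_mem_left _ hq)
  let φ : hT.subfield[X] →+* F := (aeval θ : hT.subfield[X] →ₐ[hT.subfield] F).toRingHom
  have hφ : ∀ q, φ q = 0 ↔ q ∈ hQ.support := fun q => by
    rw [hker _ hQ.isPrime_support.ne_top hpQ, ← RingHom.mem_ker,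
      hker _ (RingHom.ker_ne_top φ) hθ]
  obtain ⟨T', hT', hQT'⟩ := hQ.exists_isSubfieldCone φ hφ
  have hle : T ≤ T' := fun z hz => by
    have h := hQT' (C ⟨z, Or.inl hz⟩) (hPQ (hsub _ (AddSubmonoid.subset_closure
      ⟨⟨z, Or.inl hz⟩, (hT.nonneg_iff _).2 hz, 1, by simp⟩)))
    simpa [φ, Algebra.algebraMap_eq_smul_one, Subfield.smul_def] using h
  have hge : T' ≤ T := hmax.le_of_ge hT' hle
  have hθmem : θ ∈ hT.subfield := by
    rw [hT.mem_subfield]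
    refine (hQ.total X).imp (fun h => hge ?_) (fun h => hge ?_)
    · simpa [φ] using hQT' _ h
    · simpa [φ] using hQT' _ h
  set c : hT.subfield := ⟨θ, hθmem⟩
  have hroot : p.IsRoot c := by
    have : aeval (algebraMap hT.subfield F c) p = 0 := hθ
    rw [aeval_algebraMap_apply, map_eq_zero_iff _ (algebraMap hT.subfield F).injective] at this
    simpa using this
  obtain ⟨q, hq⟩ := dvd_iff_isRoot.2 hroot
  have hunit : IsUnit q := (hp.isUnit_or_isUnit hq).resolve_left (not_isUnit_X_sub_C c)
  obtain ⟨k, -, rfl⟩ := Polynomial.isUnit_iff.1 hunit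
  rw [hq] at hsign
  simp only [eval_mul, eval_sub, eval_X, eval_C] at hsign
  have h1 : (a - c) * (b - c) * (k * k) < 0 := by linarith
  have h2 : (a - c) * (b - c) < 0 := by
    by_contra h
    exact absurd h1 (not_lt.2 (mul_nonneg (not_lt.1 h) (mul_self_nonneg k)))
  rcases mul_neg_iff.1 h2 with ⟨h3, h4⟩ | ⟨h3, h4⟩
  · exact absurd (h3.trans' h4) (by simpa using hab.le)
  · exact ⟨c, sub_neg.1 h3, sub_pos.1 h4, hroot⟩

end IsSubfieldCone

universe u

/-- Every proper preordering of a ring is nonnegative at a point with values in an ordered field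
with the intermediate value property for polynomials. -/
theorem exists_ringHom_nonneg {A : Type u} [CommRing A] (P : Subsemiring A)
    (hP : ∀ a, a * a ∈ P) (h1 : -1 ∉ P) :
    ∃ (R : Type u) (_ : Field R) (_ : LinearOrder R) (_ : IsStrictOrderedRing R) (φ : A →+* R),
      PolyIVT R ∧ ∀ a ∈ P, 0 ≤ φ a := by
  obtain ⟨Q, hPQ, hQ⟩ := exists_isPrimeCone P hP h1
  have := hQ.isPrime_support
  let F := AlgebraicClosure (FractionRing (A ⧸ hQ.support))
  let φ : A →+* F := (algebraMap (FractionRing (A ⧸ hQ.support)) F).comp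
    ((algebraMap (A ⧸ hQ.support) (FractionRing (A ⧸ hQ.support))).comp
      (Ideal.Quotient.mk hQ.support))
  have hφ : ∀ a, φ a = 0 ↔ a ∈ hQ.support := fun a => by
    simp only [φ, RingHom.comp_apply]
    rw [map_eq_zero_iff _ (algebraMap (FractionRing (A ⧸ hQ.support)) F).injective,
      map_eq_zero_iff _ (IsFractionRing.injective (A ⧸ hQ.support) _),
      Ideal.Quotient.eq_zero_iff_mem]
  obtain ⟨T₀, hT₀, hQT₀⟩ := hQ.exists_isSubfieldCone φ hφ
  obtain ⟨T, hle, hmax⟩ := hT₀.exists_maximal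
  have hT : IsSubfieldCone T := hmax.prop
  refine ⟨hT.subfield, inferInstance, hT.linearOrder, hT.isStrictOrderedRing,
    φ.codRestrict hT.subfield fun a => ?_, hT.polyIVT_of_maximal hmax, fun a ha => ?_⟩
  · refine (hQ.total a).imp (fun h => hle (hQT₀ _ h)) fun h => ?_
    rw [← map_neg]
    exact hle (hQT₀ _ h)
  · exact (hT.nonneg_iff _).2 (hle (hQT₀ _ (hPQ ha)))

theorem polyIVT_real : PolyIVT ℝ := by
  intro p a b hab h
  rcases mul_neg_iff.1 h with ⟨h1, h2⟩ | ⟨h1, h2⟩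
  · obtain ⟨c, hc, h⟩ := intermediate_value_Ioo' hab.le p.continuous.continuousOn
      (show (0 : ℝ) ∈ Set.Ioo _ _ from ⟨h2, h1⟩)
    exact ⟨c, hc.1, hc.2, h⟩
  · obtain ⟨c, hc, h⟩ := intermediate_value_Ioo hab.le p.continuous.continuousOn
      (show (0 : ℝ) ∈ Set.Ioo _ _ from ⟨h1, h2⟩)
    exact ⟨c, hc.1, hc.2, h⟩

section Archimedean

/-- The multiplicative monoid of the elements `h² g^β`. -/
def squareMultiples {A : Type*} [CommRing A] {m : ℕ} (g : Fin m → A) : Submonoid A where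
  carrier := {z | ∃ (h : A) (β : Fin m → Bool), z = h ^ 2 * ∏ j, if β j then g j else 1}
  mul_mem' := by
    rintro _ _ ⟨h, β, rfl⟩ ⟨k, γ, rfl⟩
    refine ⟨h * k * ∏ j, if β j && γ j then g j else 1, fun j => xor (β j) (γ j), ?_⟩
    have key : (∏ j, if β j then g j else 1) * (∏ j, if γ j then g j else 1) =
        (∏ j, if β j && γ j then g j else 1) ^ 2 * ∏ j, if xor (β j) (γ j) then g j else 1 := by
      rw [← Finset.prod_pow, ← Finset.prod_mul_distrib, ← Finset.prod_mul_distrib]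
      refine Finset.prod_congr rfl fun j _ => ?_
      cases β j <;> cases γ j <;> simp [sq]
    linear_combination (h * k) ^ 2 * key
  one_mem' := ⟨1, fun _ => false, by simp⟩

lemma sq_mem_squareMultiples {A : Type*} [CommRing A] {m : ℕ} (g : Fin m → A) (a : A) :
    a ^ 2 ∈ squareMultiples g :=
  ⟨a, fun _ => false, by simp⟩

lemma self_mem_squareMultiples {A : Type*} [CommRing A] {m : ℕ} (g : Fin m → A) (j : Fin m) :
    g j ∈ squareMultiples g :=
  ⟨1, fun i => decide (i = j), by simp⟩

/-- The preordering generated by a finite family. -/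
def preorderingClosure {A : Type*} [CommRing A] {m : ℕ} (g : Fin m → A) : Subsemiring A :=
  (squareMultiples g).subsemiringClosure

lemma squareMultiples_subset_preorderingClosure {A : Type*} [CommRing A] {m : ℕ} {g : Fin m → A}
    {a : A} (ha : a ∈ squareMultiples g) : a ∈ preorderingClosure g :=
  AddSubmonoid.subset_closure ha

lemma mul_self_mem_preorderingClosure {A : Type*} [CommRing A] {m : ℕ} (g : Fin m → A) (a : A) :
    a * a ∈ preorderingClosure g :=
  squareMultiples_subset_preorderingClosure (sq a ▸ sq_mem_squareMultiples g a)

variable {n : ℕ}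

lemma MvPolynomial.C_mem_of_nonneg {S : Subsemiring (MvPolynomial (Fin n) ℝ)}
    (hS : ∀ a, a * a ∈ S) {c : ℝ} (hc : 0 ≤ c) : MvPolynomial.C c ∈ S := by
  have := hS (MvPolynomial.C (Real.sqrt c))
  rwa [← MvPolynomial.C_mul, Real.mul_self_sqrt hc] at this

/-- A preordering is archimedean as soon as it contains `N - ∑ Xᵢ²` for some `N`. -/
lemma archimedean_of_sub_sum_sq_mem {S : Subsemiring (MvPolynomial (Fin n) ℝ)}
    (hS : ∀ a, a * a ∈ S) {N : ℝ} (hN : MvPolynomial.C N - ∑ i, MvPolynomial.X i ^ 2 ∈ S)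
    (a : MvPolynomial (Fin n) ℝ) :
    ∃ c : ℝ, MvPolynomial.C c - a ∈ S := by
  suffices H : ∃ c : ℝ, MvPolynomial.C c - a ∈ S ∧ MvPolynomial.C c + a ∈ S by
    obtain ⟨c, h, -⟩ := H
    exact ⟨c, h⟩
  have hC : ∀ {c : ℝ}, 0 ≤ c → MvPolynomial.C c ∈ S := MvPolynomial.C_mem_of_nonneg hS
  induction a using MvPolynomial.induction_on with
  | C a =>
    refine ⟨|a|, ?_, ?_⟩
    · rw [← MvPolynomial.C_sub]
      exact hC (sub_nonneg.2 (le_abs_self a))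
    · rw [← MvPolynomial.C_add]
      exact hC (by linarith [neg_abs_le a])
  | add p q hp hq =>
    obtain ⟨c, h1, h2⟩ := hp
    obtain ⟨d, h3, h4⟩ := hq
    refine ⟨c + d, ?_, ?_⟩
    · have := add_mem h1 h3
      rwa [sub_add_sub_comm, ← MvPolynomial.C_add] at this
    · have := add_mem h2 h4
      rwa [add_add_add_comm, ← MvPolynomial.C_add] at this
  | mul_X p i hp =>
    obtain ⟨c, h1, h2⟩ := hp
    have hX : MvPolynomial.C N - MvPolynomial.X i ^ 2 ∈ S := by
      rw [← Finset.add_sum_erase _ _ (Finset.mem_univ i)] at hN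
      have hsum : ∑ j ∈ Finset.univ.erase i, MvPolynomial.X j ^ 2 ∈ S :=
        sum_mem fun j _ => by rw [sq]; exact hS _
      have := add_mem hN hsum
      rwa [← sub_sub, sub_add_cancel] at this
    have hhalf : MvPolynomial.C (1 / 2 : ℝ) ∈ S := hC (by norm_num)
    have e1 : (MvPolynomial.C (1 / 2) + MvPolynomial.C (1 / 2) : MvPolynomial (Fin n) ℝ) = 1 := by
      rw [← MvPolynomial.C_add]
      norm_num
    have e2 : (MvPolynomial.C (N + 1 / 4) : MvPolynomial (Fin n) ℝ) =
        MvPolynomial.C N + MvPolynomial.C (1 / 2) * MvPolynomial.C (1 / 2) := by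
      rw [← MvPolynomial.C_mul, ← MvPolynomial.C_add]
      norm_num
    have h3 : MvPolynomial.C (N + 1 / 4) - MvPolynomial.X i ∈ S := by
      convert add_mem hX (hS (MvPolynomial.X i - MvPolynomial.C (1 / 2))) using 1
      linear_combination e2 + MvPolynomial.X i * e1
    have h4 : MvPolynomial.C (N + 1 / 4) + MvPolynomial.X i ∈ S := by
      convert add_mem hX (hS (MvPolynomial.X i + MvPolynomial.C (1 / 2))) using 1
      linear_combination e2 - MvPolynomial.X i * e1
    refine ⟨c * (N + 1 / 4), ?_, ?_⟩
    · convert mul_mem hhalf (add_mem (mul_mem h1 h4) (mul_mem h2 h3)) using 1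
      rw [MvPolynomial.C_mul]
      linear_combination (p * MvPolynomial.X i - MvPolynomial.C c * MvPolynomial.C (N + 1 / 4)) * e1
    · convert mul_mem hhalf (add_mem (mul_mem h1 h3) (mul_mem h2 h4)) using 1
      rw [MvPolynomial.C_mul]
      linear_combination
        (-p * MvPolynomial.X i - MvPolynomial.C c * MvPolynomial.C (N + 1 / 4)) * e1

lemma exists_mul_eq_one_add {m : ℕ} (g : Fin m → MvPolynomial (Fin n) ℝ)
    (h : MvPolynomial (Fin n) ℝ)
    (hpos : ∀ x, (∀ j, 0 ≤ MvPolynomial.eval x (g j)) → 0 < MvPolynomial.eval x h) :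
    ∃ p ∈ preorderingClosure g, ∃ q ∈ preorderingClosure g, h * p = 1 + q := by
  classical
  by_contra! hcon
  set P := preorderingClosure g
  have hP : ∀ a, a * a ∈ P := mul_self_mem_preorderingClosure g
  obtain ⟨R, _, _, _, φ, hR, hφ⟩ := exists_ringHom_nonneg (P.adjoinElement hP (-h))
    (fun a => P.le_adjoinElement hP _ (hP a)) (by
      rintro ⟨x, hx, y, hy, e⟩
      exact hcon y hy x hx (by linear_combination e))
  obtain ⟨ψ, hψ⟩ := exists_algHom_sign_eq hR polyIVT_real n φ (insert h (Finset.univ.image g))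
  have heval : ∀ p, MvPolynomial.eval (fun i => ψ (MvPolynomial.X i)) p = ψ p := fun p => by
    rw [← MvPolynomial.coe_aeval_eq_eval]
    exact (DFunLike.congr_fun (MvPolynomial.aeval_unique ψ) p).symm
  have h1 := hpos (fun i => ψ (MvPolynomial.X i)) fun j => by
    rw [heval, ← sign_nonneg_iff, ← hψ _ (Finset.mem_insert_of_mem
      (Finset.mem_image_of_mem _ (Finset.mem_univ j))), sign_nonneg_iff]
    exact hφ _ (P.le_adjoinElement hP _
      (squareMultiples_subset_preorderingClosure (self_mem_squareMultiples g j)))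
  have h2 := hφ _ (P.self_mem_adjoinElement hP (-h))
  rw [heval, ← sign_eq_one_iff, ← hψ _ (Finset.mem_insert_self _ _), sign_eq_one_iff] at h1
  rw [map_neg] at h2
  linarith

/-- The preordering of a compact basic closed semialgebraic set is archimedean. -/
theorem preorderingClosure_archimedean {m : ℕ} (g : Fin m → MvPolynomial (Fin n) ℝ)
    (hK : IsCompact {x : Fin n → ℝ | ∀ j, 0 ≤ MvPolynomial.eval x (g j)})
    (a : MvPolynomial (Fin n) ℝ) :
    ∃ c : ℝ, MvPolynomial.C c - a ∈ preorderingClosure g := by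
  set P := preorderingClosure g
  have hP : ∀ a, a * a ∈ P := mul_self_mem_preorderingClosure g
  obtain ⟨N, hN0, hN⟩ : ∃ N : ℝ, 0 ≤ N ∧ ∀ x : Fin n → ℝ, (∀ j, 0 ≤ MvPolynomial.eval x (g j)) →
      0 < MvPolynomial.eval x (MvPolynomial.C N - ∑ i, MvPolynomial.X i ^ 2) := by
    obtain ⟨B, hB⟩ := hK.bddAbove_image
      (f := fun x => ∑ i, x i ^ 2) (by fun_prop)
    refine ⟨|B| + 1, by positivity, fun x hx => ?_⟩
    have := hB ⟨x, hx, rfl⟩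
    simp only [map_sub, MvPolynomial.eval_C, map_sum, map_pow, MvPolynomial.eval_X]
    linarith [le_abs_self B]
  set h : MvPolynomial (Fin n) ℝ := MvPolynomial.C N - ∑ i, MvPolynomial.X i ^ 2 with hh
  obtain ⟨p, hp, q, hq, hpq⟩ := exists_mul_eq_one_add g h hN
  let S₀ : Subsemiring (MvPolynomial (Fin n) ℝ) := Subsemiring.sumSq _
  have hS₀ : ∀ a, a * a ∈ S₀ := fun a => by simp [S₀]
  have hS₀P : S₀ ≤ P := fun z hz => by
    have hz : IsSumSq z := by simpa [S₀] using hz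
    induction hz with
    | zero => exact zero_mem P
    | sq_add a _ ih => exact add_mem (hP a) (ih (by simpa [S₀]))
  obtain ⟨M, σ, hσ, τ, hτ, hM⟩ := archimedean_of_sub_sum_sq_mem
    (S := S₀.adjoinElement hS₀ h) (fun a => S₀.le_adjoinElement hS₀ h (hS₀ a))
    (S₀.self_mem_adjoinElement hS₀ h) q
  have hC : ∀ {c : ℝ}, 0 ≤ c → MvPolynomial.C c ∈ P := MvPolynomial.C_mem_of_nonneg hP
  have hq' : MvPolynomial.C (M + M ^ 2 / 4) - q ∈ P := by
    have h1 : (1 + q) * σ + p * (h * h) * τ +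
        (q - MvPolynomial.C (M / 2)) * (q - MvPolynomial.C (M / 2)) ∈ P :=
      add_mem (add_mem (mul_mem (add_mem (one_mem P) hq) (hS₀P hσ))
        (mul_mem (mul_mem hp (hP h)) (hS₀P hτ))) (hP _)
    convert h1 using 1
    have e1 : (MvPolynomial.C (M + M ^ 2 / 4) : MvPolynomial (Fin n) ℝ) =
        MvPolynomial.C M + MvPolynomial.C (M / 2) * MvPolynomial.C (M / 2) := by
      rw [← MvPolynomial.C_mul, ← MvPolynomial.C_add]
      ring_nf
    have e2 : (MvPolynomial.C M : MvPolynomial (Fin n) ℝ) = 2 * MvPolynomial.C (M / 2) := by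
      rw [two_mul, ← MvPolynomial.C_add]
      ring_nf
    linear_combination e1 - q * e2 + (1 + q) * hM - h * τ * hpq
  refine archimedean_of_sub_sum_sq_mem hP (N := N + N * (M + M ^ 2 / 4)) ?_ a
  have h2 : p * (h * h) + q * ∑ i, MvPolynomial.X i * MvPolynomial.X i +
      MvPolynomial.C N * (MvPolynomial.C (M + M ^ 2 / 4) - q) ∈ P :=
    add_mem (add_mem (mul_mem hp (hP h)) (mul_mem hq (sum_mem fun i _ => hP _)))
      (mul_mem (hC hN0) hq')
  convert h2 using 1
  simp only [← sq]
  rw [MvPolynomial.C_add, MvPolynomial.C_mul]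
  linear_combination (-1 - q) * hh - h * hpq
end Archimedean

section PureState

variable {A V : Type*} [CommRing A] [Algebra ℝ A] [AddCommGroup V] [Module ℝ V] [Module A V]
  [IsScalarTower ℝ A V]

/-- An element outside a convex cone with order unit is separated from it by a state. -/
lemma exists_state_nonpos {V : Type*} [AddCommGroup V] [Module ℝ V] (M : AddSubmonoid V)
    (hsmul : ∀ c : ℝ, 0 ≤ c → ∀ v ∈ M, c • v ∈ M) {e : V} (he : e ∈ M)
    (hunit : ∀ v, ∃ N : ℝ, N • e + v ∈ M) {f : V} (hf : f ∉ M) :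
    ∃ L : V →ₗ[ℝ] ℝ, (∀ v ∈ M, 0 ≤ L v) ∧ L e = 1 ∧ L f ≤ 0 := by
  have he0 : e ≠ 0 := by
    rintro rfl
    obtain ⟨N, h⟩ := hunit f
    exact hf (by simpa using h)
  let M' : PointedCone ℝ V :=
    { carrier := {x | ∃ m ∈ M, ∃ c : ℝ, 0 ≤ c ∧ x = m - c • f}
      zero_mem' := ⟨0, zero_mem M, 0, le_rfl, by simp⟩
      smul_mem' := by
        rintro ⟨r, hr⟩ _ ⟨m, hm, c, hc, rfl⟩
        exact ⟨r • m, hsmul r hr m hm, r * c, mul_nonneg hr hc, by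
          rw [Nonneg.mk_smul, smul_sub, mul_smul]⟩
      add_mem' := by
        rintro _ _ ⟨m, hm, c, hc, rfl⟩ ⟨m', hm', c', hc', rfl⟩
        exact ⟨m + m', add_mem hm hm', c + c', add_nonneg hc hc', by rw [add_smul]; abel⟩ }
  have hMM' : ∀ m ∈ M, m ∈ M' := fun m hm => ⟨m, hm, 0, le_rfl, by simp⟩
  obtain ⟨L, hL, hLM⟩ := riesz_extension M' (LinearPMap.mkSpanSingleton e (1 : ℝ) he0) (by
    rintro ⟨x, hx⟩ hxM
    obtain ⟨r, rfl⟩ := Submodule.mem_span_singleton.1 hx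
    rw [LinearPMap.mkSpanSingleton'_apply]
    rw [RingHom.id_apply, smul_eq_mul, mul_one]
    by_contra! hr
    obtain ⟨m, hm, c, hc, h⟩ := hxM
    simp only at h
    have h1 : c • f ∈ M := by
      have : c • f = m + (-r) • e := by rw [neg_smul, h]; abel
      rw [this]
      exact add_mem hm (hsmul _ (by linarith) e he)
    rcases hc.eq_or_lt with rfl | hc
    · obtain ⟨N, hN⟩ := hunit f
      have h2 : -e ∈ M := by
        rw [zero_smul, sub_zero] at h
        have : -e = (-r)⁻¹ • m := by
          rw [← h, smul_smul, inv_neg, neg_mul, inv_mul_cancel₀ hr.ne, neg_smul, one_smul]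
        rw [this]
        exact hsmul _ (inv_nonneg.2 (by linarith)) m hm
      apply hf
      have : f = (N • e + f) + (|N| • -e + (|N| - N) • e) := by
        rw [smul_neg, sub_smul]; abel
      rw [this]
      exact add_mem hN (add_mem (hsmul _ (abs_nonneg _) _ h2)
        (hsmul _ (sub_nonneg.2 (le_abs_self N)) _ he))
    · apply hf
      have : f = c⁻¹ • c • f := by rw [smul_smul, inv_mul_cancel₀ hc.ne', one_smul]
      rw [this]
      exact hsmul _ (inv_nonneg.2 hc.le) _ h1) (fun y => by
    obtain ⟨N, hN⟩ := hunit y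
    exact ⟨⟨N • e, Submodule.smul_mem _ _ (Submodule.mem_span_singleton_self e)⟩, hMM' _ hN⟩)
  refine ⟨L, fun v hv => hLM v (hMM' v hv), ?_, ?_⟩
  · have h := hL ⟨(1 : ℝ) • e, Submodule.smul_mem _ _ (Submodule.mem_span_singleton_self e)⟩
    rw [LinearPMap.mkSpanSingleton'_apply] at h
    simpa using h
  · have := hLM (-f) ⟨0, zero_mem M, 1, zero_le_one, by simp⟩
    rw [map_neg] at this
    linarith

/-- The states of a cone, as functions. -/
def stateSpace {V : Type*} [AddCommGroup V] [Module ℝ V] (M : AddSubmonoid V) (e : V) :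
    Set (V → ℝ) :=
  {L | (∀ u v, L (u + v) = L u + L v) ∧ (∀ (c : ℝ) v, L (c • v) = c * L v) ∧
    (∀ v ∈ M, 0 ≤ L v) ∧ L e = 1}

lemma isCompact_stateSpace {V : Type*} [AddCommGroup V] [Module ℝ V] (M : AddSubmonoid V) {e : V}
    (hunit : ∀ v, ∃ N : ℝ, N • e + v ∈ M) : IsCompact (stateSpace M e) := by
  choose N hN using hunit
  refine (isCompact_univ_pi fun v => isCompact_Icc (a := -N v) (b := N (-v))).of_isClosed_subset
    ?_ ?_
  · simp only [stateSpace, Set.ofPred_and, Set.ofPred_forall]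
    refine IsClosed.inter (isClosed_iInter fun u => isClosed_iInter fun v => ?_)
      (IsClosed.inter (isClosed_iInter fun c => isClosed_iInter fun v => ?_)
      (IsClosed.inter (isClosed_iInter fun v => isClosed_iInter fun _ => ?_) ?_))
    · exact isClosed_eq (by fun_prop) (by fun_prop)
    · exact isClosed_eq (by fun_prop) (by fun_prop)
    · exact isClosed_le (by fun_prop) (by fun_prop)
    · exact isClosed_eq (by fun_prop) (by fun_prop)
  · rintro L ⟨hadd, hsmul, hpos, h1⟩ v -
    have e1 := hpos _ (hN v)
    have e2 := hpos _ (hN (-v))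
    rw [hadd, hsmul, h1] at e1 e2
    have e3 : L (-v) = - L v := by
      have := hsmul (-1) v
      rwa [neg_one_smul, neg_one_mul] at this
    rw [e3] at e2
    constructor <;> linarith

/-- The two-sided form of the archimedean property. -/
lemma exists_pos_sub_mem_add_mem {A : Type*} [CommRing A] [Algebra ℝ A] (P : Subsemiring A)
    (hP : ∀ c : ℝ, 0 ≤ c → algebraMap ℝ A c ∈ P)
    (harch : ∀ a, ∃ c : ℝ, algebraMap ℝ A c - a ∈ P) (a : A) :
    ∃ c : ℝ, 0 < c ∧ algebraMap ℝ A c - a ∈ P ∧ algebraMap ℝ A c + a ∈ P := by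
  obtain ⟨c₁, hc₁⟩ := harch a
  obtain ⟨c₂, hc₂⟩ := harch (-a)
  set c := |c₁| + |c₂| + 1 with hc
  refine ⟨c, by positivity, ?_, ?_⟩
  · have := add_mem hc₁ (hP (c - c₁) (by rw [hc]; linarith [le_abs_self c₁, abs_nonneg c₂]))
    rwa [map_sub, sub_add_sub_cancel'] at this
  · have := add_mem hc₂ (hP (c - c₂) (by rw [hc]; linarith [le_abs_self c₂, abs_nonneg c₁]))
    rwa [map_sub, sub_add_sub_cancel', sub_neg_eq_add] at this

/-- The multiplicativity of extreme states on a module cone. -/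
lemma stateSpace_map_smul (P : Subsemiring A) (hP : ∀ c : ℝ, 0 ≤ c → algebraMap ℝ A c ∈ P)
    (harch : ∀ a, ∃ c : ℝ, algebraMap ℝ A c - a ∈ P) (M : AddSubmonoid V)
    (hM : ∀ a ∈ P, ∀ v ∈ M, a • v ∈ M) {e : V} (he : e ∈ M)
    (hunit : ∀ v, ∃ N : ℝ, N • e + v ∈ M) {L : V → ℝ} (hL : L ∈ stateSpace M e)
    (hext : ∀ L₁ ∈ stateSpace M e, ∀ L₂ ∈ stateSpace M e, ∀ c : ℝ, 0 < c → c < 1 →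
      L = c • L₁ + (1 - c) • L₂ → L₁ = L) (a : A) (v : V) :
    L (a • v) = L (a • e) * L v := by
  obtain ⟨hadd, hsmul, hpos, h1⟩ := hL
  have hsub : ∀ u v, L (u - v) = L u - L v := fun u v => by
    rw [sub_eq_add_neg, hadd, ← neg_one_smul ℝ v, hsmul]; ring
  have hzero : ∀ a ∈ P, L (a • e) = 0 → ∀ v, L (a • v) = 0 := fun a ha h0 v => by
    have key : ∀ v, 0 ≤ L (a • v) := fun v => by
      obtain ⟨N, hN⟩ := hunit v
      have := hpos _ (hM a ha _ hN)
      rwa [smul_add, smul_comm a N e, hadd, hsmul, h0, mul_zero, zero_add] at this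
    have h2 := key (-v)
    rw [smul_neg, ← neg_one_smul ℝ, hsmul] at h2
    linarith [key v]
  have hstate : ∀ a ∈ P, 0 < L (a • e) → (fun v => (L (a • e))⁻¹ * L (a • v)) ∈ stateSpace M e :=
    fun a ha h0 => by
      refine ⟨fun u v => ?_, fun c v => ?_, fun v hv => ?_, inv_mul_cancel₀ h0.ne'⟩
      · simp only [smul_add, hadd, mul_add]
      · simp only
        rw [smul_comm, hsmul, mul_left_comm]
      · exact mul_nonneg (inv_nonneg.2 h0.le) (hpos _ (hM a ha v hv))
  have main : ∀ a ∈ P, 1 - a ∈ P → ∀ v, L (a • v) = L (a • e) * L v := fun a ha ha' v => by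
    have hsum : ∀ v, L ((1 - a) • v) = L v - L (a • v) := fun v => by
      rw [sub_smul, one_smul, hsub]
    have c0 := hpos _ (hM a ha e he)
    have c1 := hpos _ (hM _ ha' e he)
    rcases c0.eq_or_lt with c0 | c0
    · rw [hzero a ha c0.symm, ← c0, zero_mul]
    rcases c1.eq_or_lt with c1 | c1
    · have h2 := hzero _ ha' c1.symm v
      rw [hsum, h1] at c1
      rw [hsum] at h2
      rw [← sub_eq_zero.1 c1.symm, one_mul]
      exact (sub_eq_zero.1 h2).symm
    · have h2 := hext _ (hstate a ha c0) _ (hstate _ ha' c1) (L (a • e)) c0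
        (by rw [hsum, h1] at c1; linarith) (by
          funext v
          have : 1 - L (a • e) = L ((1 - a) • e) := by rw [hsum, h1]
          simp only [this, Pi.add_apply, Pi.smul_apply, smul_eq_mul]
          rw [mul_inv_cancel_left₀ c0.ne', mul_inv_cancel_left₀ c1.ne', hsum]
          ring)
      have h3 := congrFun h2 v
      rw [← h3, mul_inv_cancel_left₀ c0.ne']
  obtain ⟨c, hcpos, hb₁, hb₂⟩ := exists_pos_sub_mem_add_mem P hP harch a
  have hscale : (0 : ℝ) ≤ (2 * c)⁻¹ := by positivity
  have e1 : algebraMap ℝ A (2 * c)⁻¹ * (algebraMap ℝ A c + algebraMap ℝ A c) = 1 := by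
    rw [← map_add, ← map_mul, ← two_mul, inv_mul_cancel₀ (by positivity), map_one]
  have key := fun v => main _ (mul_mem (hP _ hscale) hb₂) (by
    convert mul_mem (hP _ hscale) hb₁ using 1
    linear_combination -e1) v
  have hval : ∀ v, L ((algebraMap ℝ A (2 * c)⁻¹ * (algebraMap ℝ A c + a)) • v) =
      (2 * c)⁻¹ * (c * L v + L (a • v)) := fun v => by
    rw [mul_smul, algebraMap_smul, hsmul, add_smul, algebraMap_smul, hadd, hsmul]
  have h3 := key v
  rw [hval, hval, h1, mul_assoc] at h3
  have h4 := mul_left_cancel₀ (by positivity : (2 * c)⁻¹ ≠ 0) h3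
  linear_combination h4

/-- A membership criterion for cones that are modules over an archimedean preordering: it is
enough to check positivity on the pure states, which are multiplicative. -/
theorem mem_of_forall_pure_state_pos (P : Subsemiring A)
    (hP : ∀ c : ℝ, 0 ≤ c → algebraMap ℝ A c ∈ P)
    (harch : ∀ a, ∃ c : ℝ, algebraMap ℝ A c - a ∈ P) (M : AddSubmonoid V)
    (hM : ∀ a ∈ P, ∀ v ∈ M, a • v ∈ M) {e : V} (he : e ∈ M)
    (hunit : ∀ v, ∃ N : ℝ, N • e + v ∈ M) {f : V}
    (hf : ∀ (L : V →ₗ[ℝ] ℝ) (χ : A →ₐ[ℝ] ℝ), (∀ v ∈ M, 0 ≤ L v) → L e = 1 →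
      (∀ a ∈ P, 0 ≤ χ a) → (∀ a v, L (a • v) = χ a * L v) → 0 < L f) : f ∈ M := by
  by_contra hfM
  have hsmulM : ∀ c : ℝ, 0 ≤ c → ∀ v ∈ M, c • v ∈ M := fun c hc v hv => by
    rw [← algebraMap_smul A]
    exact hM _ (hP c hc) v hv
  obtain ⟨L₀, hL₀, hL₀e, hL₀f⟩ := exists_state_nonpos M hsmulM he hunit hfM
  have hcomp := isCompact_stateSpace M hunit
  have hmem₀ : (L₀ : V → ℝ) ∈ stateSpace M e :=
    ⟨map_add L₀, fun c v => by simp, hL₀, hL₀e⟩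
  obtain ⟨L₁, hL₁, hmin⟩ := hcomp.exists_isMinOn ⟨_, hmem₀⟩
    (f := fun L : V → ℝ => L f) (by fun_prop)
  let F : Set (V → ℝ) := stateSpace M e ∩ {L | L f = L₁ f}
  have hF : IsCompact F := hcomp.inter_right (isClosed_eq (by fun_prop) (by fun_prop))
  obtain ⟨L, hL⟩ := hF.extremePoints_nonempty ⟨L₁, hL₁, rfl⟩
  rw [mem_extremePoints] at hL
  obtain ⟨⟨hLs, hLf⟩, hLext⟩ := hL
  have hmul := stateSpace_map_smul P hP harch M hM he hunit hLs fun K₁ hK₁ K₂ hK₂ c hc0 hc1 h => by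
    have h1 : L₁ f ≤ K₁ f := hmin hK₁
    have h2 : L₁ f ≤ K₂ f := hmin hK₂
    have h3 : L f = c * K₁ f + (1 - c) * K₂ f := by rw [h]; simp
    have h4 : L f = L₁ f := hLf
    have h5 : K₁ f = L₁ f := by nlinarith
    have h6 : K₂ f = L₁ f := by nlinarith
    exact (hLext K₁ ⟨hK₁, h5⟩ K₂ ⟨hK₂, h6⟩
      ⟨c, 1 - c, hc0, by linarith, by ring, h.symm⟩).1
  obtain ⟨hadd, hsmul, hpos, h1⟩ := hLs
  let L' : V →ₗ[ℝ] ℝ := { toFun := L, map_add' := hadd, map_smul' := hsmul }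
  let χ : A →ₐ[ℝ] ℝ := AlgHom.ofLinearMap
    { toFun := fun a => L (a • e)
      map_add' := fun a b => by rw [add_smul, hadd]
      map_smul' := fun c a => by rw [smul_assoc, hsmul]; rfl }
    (by simp [h1]) (fun a b => by
      simp only [LinearMap.coe_mk, AddHom.coe_mk]
      rw [mul_smul, hmul])
  have h2 : 0 < L f := hf L' χ hpos h1 (fun a ha => hpos _ (hM a ha e he)) hmul
  have h3 : L₁ f ≤ L₀ f := hmin hmem₀
  have h4 : L f = L₁ f := hLf
  linarith

end PureState

/-- A nonnegative real polynomial of degree at most `2 * d` is a sum of squares of polynomials of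
degree at most `d`. -/
theorem Polynomial.mem_closure_sq_of_nonneg (d : ℕ) :
    ∀ p : ℝ[X], p.natDegree ≤ 2 * d → (∀ t, 0 ≤ p.eval t) →
      p ∈ AddSubmonoid.closure {z : ℝ[X] | ∃ h : ℝ[X], h.natDegree ≤ d ∧ z = h ^ 2} := by
  have hconst : ∀ (d : ℕ) (c : ℝ), 0 ≤ c →
      C c ∈ AddSubmonoid.closure {z : ℝ[X] | ∃ h : ℝ[X], h.natDegree ≤ d ∧ z = h ^ 2} :=
    fun d c hc => AddSubmonoid.subset_closure
      ⟨C (Real.sqrt c), by simp, by rw [← C_pow, Real.sq_sqrt hc]⟩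
  induction d with
  | zero =>
    intro p hp hpos
    rw [eq_C_of_natDegree_le_zero hp] at hpos ⊢
    exact hconst 0 _ (by simpa using hpos 0)
  | succ d ih =>
    intro p hp hpos
    rcases Nat.eq_zero_or_pos p.natDegree with h0 | h0
    · rw [eq_C_of_natDegree_eq_zero h0] at hpos ⊢
      exact hconst _ _ (by simpa using hpos 0)
    obtain ⟨t₀, ht₀⟩ : ∃ t₀, ∀ t, p.eval t₀ ≤ p.eval t := by
      refine p.continuous.exists_forall_le ?_
      refine (p.tendsto_norm_atTop (natDegree_pos_iff_degree_pos.1 h0)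
        (tendsto_norm_cocompact_atTop (E := ℝ))).congr fun t => ?_
      rw [Real.norm_eq_abs, abs_of_nonneg (hpos t)]
    have hroot : (p - C (p.eval t₀)).IsRoot t₀ := by simp
    obtain ⟨q, hq⟩ := dvd_iff_isRoot.2 hroot
    have hder : p.derivative.eval t₀ = 0 := by
      rw [← p.deriv]
      exact IsLocalMin.deriv_eq_zero (Filter.Eventually.of_forall ht₀)
    have hq0 : q.IsRoot t₀ := by
      have := congrArg (fun r => (derivative r).eval t₀) hq
      simp only [derivative_sub, derivative_C, sub_zero, derivative_mul, derivative_X, one_mul,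
        eval_add, eval_mul, eval_sub, eval_X, eval_C, sub_self, zero_mul, add_zero] at this
      rw [IsRoot, ← this, hder]
    obtain ⟨r, rfl⟩ := dvd_iff_isRoot.2 hq0
    have hp_eq : p = (X - C t₀) ^ 2 * r + C (p.eval t₀) := by linear_combination hq
    have hrpos : ∀ t, 0 ≤ r.eval t := by
      have hclosed : IsClosed {t | 0 ≤ r.eval t} := isClosed_le continuous_const r.continuous
      have hsub : ({t₀}ᶜ : Set ℝ) ⊆ {t | 0 ≤ r.eval t} := fun t ht => by
        have h1 := ht₀ t
        have h2 := congrArg (eval t) hp_eq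
        simp only [eval_add, eval_mul, eval_pow, eval_sub, eval_X, eval_C] at h2
        have h3 : 0 < (t - t₀) ^ 2 := by have := sub_ne_zero.2 ht; positivity
        by_contra hneg
        have := mul_neg_of_pos_of_neg h3 (not_le.1 hneg)
        linarith
      exact fun t => hclosed.closure_subset_iff.2 hsub (dense_compl_singleton t₀ t)
    have hrdeg : r.natDegree ≤ 2 * d := by
      by_cases hr : r = 0
      · simp [hr]
      have h1 : (p - C (p.eval t₀)).natDegree ≤ 2 * (d + 1) := by simpa using hp
      rw [hq, ← mul_assoc, natDegree_mul (mul_ne_zero (X_sub_C_ne_zero t₀) (X_sub_C_ne_zero t₀)) hr,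
        natDegree_mul (X_sub_C_ne_zero t₀) (X_sub_C_ne_zero t₀), natDegree_X_sub_C] at h1
      omega
    rw [hp_eq]
    refine add_mem ?_ (hconst _ _ (hpos t₀))
    have := ih r hrdeg hrpos
    clear hp_eq hrdeg hrpos hq hq0
    induction this using AddSubmonoid.closure_induction with
    | mem z hz =>
      obtain ⟨h, hh, rfl⟩ := hz
      refine AddSubmonoid.subset_closure ⟨(X - C t₀) * h, ?_, by ring⟩
      refine natDegree_mul_le.trans ?_
      rw [natDegree_X_sub_C]
      omega
    | zero => simp
    | add y z _ _ hy hz =>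
      rw [mul_add]
      exact add_mem hy hz

/-- A polynomial of degree `2 * d` that is positive everywhere dominates a positive multiple of
`∑ X ^ (2 * k)`. -/
lemma Polynomial.exists_pos_mul_sum_le (d : ℕ) (q : ℝ[X]) (hdeg : q.natDegree ≤ 2 * d)
    (hlead : 0 < q.coeff (2 * d)) (hpos : ∀ t, 0 < q.eval t) :
    ∃ ε : ℝ, 0 < ε ∧ ∀ t, ε * ∑ k ∈ Finset.range (d + 1), t ^ (2 * k) ≤ q.eval t := by
  let Q : ℝ × ℝ → ℝ := fun p =>
    ∑ i ∈ Finset.range (2 * d + 1), q.coeff i * p.2 ^ i * p.1 ^ (2 * d - i)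
  have heval : ∀ t, q.eval t = ∑ i ∈ Finset.range (2 * d + 1), q.coeff i * t ^ i :=
    fun t => eval_eq_sum_range' (by omega) t
  have hscale : ∀ s t, s ≠ 0 → Q (s, t) = s ^ (2 * d) * q.eval (t / s) := fun s t hs => by
    rw [heval, Finset.mul_sum]
    refine Finset.sum_congr rfl fun i hi => ?_
    have hi' : i ≤ 2 * d := Nat.lt_succ_iff.1 (Finset.mem_range.1 hi)
    have : s ^ (2 * d) = s ^ i * s ^ (2 * d - i) := by rw [← pow_add, Nat.add_sub_cancel' hi']
    simp only
    rw [this, div_pow]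
    field_simp
  let S : Set (ℝ × ℝ) := {p | p.1 ^ 2 + p.2 ^ 2 = 1}
  have hS : IsCompact S := by
    refine (isCompact_Icc.prod isCompact_Icc : IsCompact (Set.Icc (-1 : ℝ) 1 ×ˢ Set.Icc (-1 : ℝ) 1))
      |>.of_isClosed_subset (isClosed_eq (by fun_prop) (by fun_prop)) ?_
    rintro ⟨s, t⟩ (h : s ^ 2 + t ^ 2 = 1)
    exact ⟨abs_le.1 (abs_le_one_iff_mul_self_le_one.2 (by nlinarith [sq_nonneg t])),
      abs_le.1 (abs_le_one_iff_mul_self_le_one.2 (by nlinarith [sq_nonneg s]))⟩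
  obtain ⟨⟨s₀, t₀⟩, h₀, hmin⟩ := hS.exists_isMinOn ⟨(1, 0), by simp [S]⟩
    (f := Q) (by fun_prop)
  have hμ : 0 < Q (s₀, t₀) := by
    by_cases hs : s₀ = 0
    · subst hs
      have ht : t₀ ^ 2 = 1 := by simpa [S] using h₀
      have : Q (0, t₀) = q.coeff (2 * d) := by
        simp only [Q]
        rw [Finset.sum_range_succ, Finset.sum_eq_zero, Nat.sub_self, pow_mul, ht]
        · simp
        · intro i hi
          rw [zero_pow (by have := Finset.mem_range.1 hi; omega), mul_zero]
      rwa [this]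
    · rw [hscale _ _ hs]
      exact mul_pos ((even_two_mul d).pow_pos hs) (hpos _)
  refine ⟨Q (s₀, t₀) / (d + 1), by positivity, fun t => ?_⟩
  have hsum : ∑ k ∈ Finset.range (d + 1), t ^ (2 * k) ≤ (d + 1) * (1 + t ^ 2) ^ d := by
    have : ∀ k ∈ Finset.range (d + 1), t ^ (2 * k) ≤ (1 + t ^ 2) ^ d := fun k hk => by
      rw [pow_mul]
      exact (pow_le_pow_left₀ (sq_nonneg t) (by linarith) k).trans
        (pow_le_pow_right₀ (by nlinarith [sq_nonneg t]) (Nat.lt_succ_iff.1 (Finset.mem_range.1 hk)))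
    simpa using Finset.sum_le_card_nsmul _ _ _ this
  have hr : 0 < Real.sqrt (1 + t ^ 2) := Real.sqrt_pos.2 (by positivity)
  have hrr : Real.sqrt (1 + t ^ 2) ^ 2 = 1 + t ^ 2 := Real.sq_sqrt (by positivity)
  set r := Real.sqrt (1 + t ^ 2)
  have h1 : Q (s₀, t₀) ≤ Q (1 / r, t / r) := hmin (by
    change (1 / r) ^ 2 + (t / r) ^ 2 = 1
    rw [div_pow, div_pow, hrr]
    field_simp)
  rw [hscale (1 / r) (t / r) (by positivity), div_div_div_cancel_right₀ hr.ne', div_one, pow_mul,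
    div_pow, hrr, one_pow, div_pow, one_pow, one_div_mul_eq_div, le_div_iff₀ (by positivity)] at h1
  calc Q (s₀, t₀) / (d + 1) * ∑ k ∈ Finset.range (d + 1), t ^ (2 * k)
      ≤ Q (s₀, t₀) / (d + 1) * ((d + 1) * (1 + t ^ 2) ^ d) := by gcongr
    _ = Q (s₀, t₀) * (1 + t ^ 2) ^ d := by field_simp
    _ ≤ q.eval t := h1

section DegreeBoundedPreordering

variable {A : Type*} [CommRing A] {m : ℕ}

/-- The additive monoid generated by the polynomials `h² g^β` with `natDegree h ≤ d`. -/
noncomputable def Polynomial.boundedPreordering (g : Fin m → A) (d : ℕ) : AddSubmonoid A[X] :=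
  AddSubmonoid.closure {z | ∃ a ∈ squareMultiples g, ∃ h : A[X], h.natDegree ≤ d ∧ z = C a * h ^ 2}

lemma Polynomial.C_mul_mem_boundedPreordering {g : Fin m → A} {d : ℕ} {a : A}
    (ha : a ∈ preorderingClosure g) {v : A[X]} (hv : v ∈ boundedPreordering g d) :
    C a * v ∈ boundedPreordering g d := by
  have ha' : a ∈ AddSubmonoid.closure (squareMultiples g : Set A) := ha
  induction hv using AddSubmonoid.closure_induction with
  | mem z hz =>
    obtain ⟨b, hb, h, hh, rfl⟩ := hz
    induction ha' using AddSubmonoid.closure_induction with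
    | mem a hmem =>
      exact AddSubmonoid.subset_closure ⟨a * b, mul_mem hmem hb, h, hh, by rw [C_mul, mul_assoc]⟩
    | zero => simp
    | add x y hx hy ihx ihy =>
      rw [C_add, add_mul]
      exact add_mem (ihx hx) (ihy hy)
  | zero => simp
  | add y z _ _ hy hz =>
    rw [mul_add]
    exact add_mem hy hz

lemma Polynomial.sq_mem_boundedPreordering (g : Fin m → A) {d : ℕ} {h : A[X]}
    (hh : h.natDegree ≤ d) : h ^ 2 ∈ boundedPreordering g d :=
  AddSubmonoid.subset_closure ⟨1, one_mem _, h, hh, by simp⟩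

lemma Polynomial.sum_pow_mem_boundedPreordering (g : Fin m → A) {d : ℕ} {s : Finset ℕ}
    (hs : s ⊆ Finset.range (d + 1)) :
    ∑ k ∈ s, (X : A[X]) ^ (2 * k) ∈ boundedPreordering g d :=
  sum_mem fun k hk => by
    rw [mul_comm, pow_mul]
    refine sq_mem_boundedPreordering g ((natDegree_X_pow_le k).trans ?_)
    exact Nat.lt_succ_iff.1 (Finset.mem_range.1 (hs hk))

/-- The even powers of the variable sum up to an order unit. -/
lemma Polynomial.exists_smul_sum_add_mem_boundedPreordering [Algebra ℝ A] {g : Fin m → A}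
    (hP : ∀ c : ℝ, 0 ≤ c → algebraMap ℝ A c ∈ preorderingClosure g)
    (harch : ∀ a, ∃ c : ℝ, algebraMap ℝ A c - a ∈ preorderingClosure g) {d : ℕ} {v : A[X]}
    (hv : v.natDegree ≤ 2 * d) :
    ∃ N : ℝ, N • ∑ k ∈ Finset.range (d + 1), X ^ (2 * k) + v ∈ boundedPreordering g d := by
  set e : A[X] := ∑ k ∈ Finset.range (d + 1), X ^ (2 * k) with he
  have hmono : ∀ (a : A) (j k : ℕ), j ≤ d → k ≤ d →
      ∃ N : ℝ, N • e + C a * X ^ (j + k) ∈ boundedPreordering g d := by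
    intro a j k hj hk
    obtain ⟨c, hc, h₁, h₂⟩ := exists_pos_sub_mem_add_mem _ hP harch a
    have hsq : ∀ {i}, i ≤ d → e - X ^ (2 * i) ∈ boundedPreordering g d := fun {i} hi => by
      rw [he, ← Finset.sum_erase_eq_sub (Finset.mem_range.2 (by omega))]
      exact sum_pow_mem_boundedPreordering g (Finset.erase_subset _ _)
    have hdeg : ∀ {i}, i ≤ d → (X ^ i : A[X]).natDegree ≤ d :=
      fun hi => (natDegree_X_pow_le _).trans hi
    have hscal : ∀ {r : ℝ} {w : A[X]}, 0 ≤ r → w ∈ boundedPreordering g d →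
        C (algebraMap ℝ A r) * w ∈ boundedPreordering g d :=
      fun hr hw => C_mul_mem_boundedPreordering (hP _ hr) hw
    have hsum := add_mem (add_mem
      (hscal (r := 1 / 4) (by norm_num) (add_mem
        (C_mul_mem_boundedPreordering h₂ (sq_mem_boundedPreordering g
          (natDegree_add_le_of_degree_le (hdeg hj) (hdeg hk))))
        (C_mul_mem_boundedPreordering h₁ (sq_mem_boundedPreordering g
          (natDegree_sub_le_of_le (hdeg hj) (hdeg hk) |>.trans (max_self d).le)))))
      (hscal (r := c / 2) (by positivity) (hsq hj)))
      (hscal (r := c / 2) (by positivity) (hsq hk))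
    refine ⟨c, ?_⟩
    convert hsum using 1
    have h4 : (C (algebraMap ℝ A (1 / 4)) : A[X]) * 4 = 1 := by
      rw [← C_ofNat, ← C_mul, ← map_ofNat (algebraMap ℝ A) 4, ← map_mul]
      norm_num
    have hc2 : (C (algebraMap ℝ A (c / 2)) : A[X]) * 2 = C (algebraMap ℝ A c) := by
      rw [← C_ofNat, ← C_mul, ← map_ofNat (algebraMap ℝ A) 2, ← map_mul]
      norm_num
    have hc4 : (C (algebraMap ℝ A (1 / 4)) : A[X]) * C (algebraMap ℝ A c) * 2 =
        C (algebraMap ℝ A (c / 2)) := by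
      linear_combination (C (algebraMap ℝ A (c / 2)) : A[X]) * h4 -
        2 * (C (algebraMap ℝ A (1 / 4)) : A[X]) * hc2
    rw [← algebraMap_smul A c e, smul_eq_C_mul, C_add, C_sub, pow_add, mul_comm 2 j, mul_comm 2 k,
      pow_mul, pow_mul]
    linear_combination -((X ^ j) ^ 2 + (X ^ k) ^ 2) * hc4 - e * hc2 - C a * X ^ j * X ^ k * h4
  have hall : ∀ s ⊆ Finset.range (2 * d + 1),
      ∃ N : ℝ, N • e + ∑ i ∈ s, C (v.coeff i) * X ^ i ∈ boundedPreordering g d := by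
    intro s
    induction s using Finset.induction_on with
    | empty => exact fun _ => ⟨0, by simp⟩
    | insert i s hi ih =>
      intro hs
      obtain ⟨N, hN⟩ := ih ((Finset.subset_insert i s).trans hs)
      have hid := Finset.mem_range.1 (hs (Finset.mem_insert_self i s))
      obtain ⟨N', hN'⟩ := hmono (v.coeff i) (i / 2) (i - i / 2) (by omega) (by omega)
      rw [Nat.add_sub_cancel' (Nat.div_le_self i 2)] at hN'
      refine ⟨N' + N, ?_⟩
      rw [Finset.sum_insert hi, add_smul, add_add_add_comm]
      exact add_mem hN' hN
  obtain ⟨N, hN⟩ := hall _ subset_rfl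
  exact ⟨N, by rwa [← v.as_sum_range_C_mul_X_pow' (by omega)] at hN⟩

/-- Elements of the bounded preordering have the form `∑ ψ_β g^β`. -/
lemma Polynomial.exists_isSumSq_of_mem_boundedPreordering {g : Fin m → A} {d : ℕ} {v : A[X]}
    (hv : v ∈ boundedPreordering g d) :
    ∃ ψ : (Fin m → Bool) → A[X], (∀ β, IsSumSq (ψ β)) ∧
      v = ∑ β : Fin m → Bool, ψ β * C (∏ j, if β j then g j else 1) := by
  induction hv using AddSubmonoid.closure_induction with
  | mem z hz =>
    obtain ⟨_, ⟨k, β, rfl⟩, h, -, rfl⟩ := hz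
    refine ⟨fun γ => if γ = β then (C k * h) * (C k * h) else 0, fun γ => ?_, ?_⟩
    · dsimp only
      split_ifs
      · exact IsSumSq.mul_self _
      · exact IsSumSq.zero
    · simp only [ite_mul, zero_mul, Finset.sum_ite_eq', Finset.mem_univ, if_true, C_mul, C_pow]
      ring
  | zero => exact ⟨0, fun _ => IsSumSq.zero, by simp⟩
  | add y z _ _ hy hz =>
    obtain ⟨ψ, hψ, rfl⟩ := hy
    obtain ⟨φ, hφ, rfl⟩ := hz
    exact ⟨ψ + φ, fun β => (hψ β).add (hφ β), by simp [add_mul, Finset.sum_add_distrib]⟩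

/-- Sums of squares of real polynomials of degree at most `d` lie in the bounded preordering. -/
lemma Polynomial.map_mem_boundedPreordering [Algebra ℝ A] (g : Fin m → A) {d : ℕ} {r : ℝ[X]}
    (hr : r ∈ AddSubmonoid.closure {z : ℝ[X] | ∃ h : ℝ[X], h.natDegree ≤ d ∧ z = h ^ 2}) :
    r.map (algebraMap ℝ A) ∈ boundedPreordering g d := by
  induction hr using AddSubmonoid.closure_induction with
  | mem z hz =>
    obtain ⟨h, hh, rfl⟩ := hz
    rw [Polynomial.map_pow]
    exact sq_mem_boundedPreordering g (natDegree_map_le.trans hh)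
  | zero => simp
  | add y z _ _ hy hz =>
    rw [Polynomial.map_add]
    exact add_mem hy hz

/-- A functional on polynomials of bounded degree that is multiplicative along a character only
depends on the image of the polynomial under the character. -/
lemma Polynomial.eq_zero_of_map_eq_zero [Algebra ℝ A] {N : ℕ} {L : degreeLE A N →ₗ[ℝ] ℝ}
    {χ : A →ₐ[ℝ] ℝ} (hL : ∀ (a : A) (v : degreeLE A N), L (a • v) = χ a * L v)
    (v : degreeLE A N) (hv : (v : A[X]).map (χ : A →+* ℝ) = 0) : L v = 0 := by
  have hX : ∀ i : Fin (N + 1), (X ^ (i : ℕ) : A[X]) ∈ degreeLE A N := fun i =>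
    mem_degreeLE.2 ((degree_X_pow_le _).trans (by exact_mod_cast Nat.lt_succ_iff.1 i.2))
  have hsum : v = ∑ i : Fin (N + 1), (v : A[X]).coeff i • (⟨X ^ (i : ℕ), hX i⟩ : degreeLE A N) := by
    ext1
    have hdeg : (v : A[X]).natDegree < N + 1 :=
      Nat.lt_succ_iff.2 (natDegree_le_iff_degree_le.2 (mem_degreeLE.1 v.2))
    rw [Submodule.coe_sum]
    conv_lhs => rw [(v : A[X]).as_sum_range_C_mul_X_pow' hdeg, Finset.sum_range]
    simp [smul_eq_C_mul]
  rw [hsum, map_sum]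
  refine Finset.sum_eq_zero fun i _ => ?_
  have : χ ((v : A[X]).coeff i) = 0 := by
    simpa using congrArg (fun p => coeff p i) hv
  rw [hL, this, zero_mul]

end DegreeBoundedPreordering

/-- Powers / Marshall. Let `K = {x : gⱼ(x) ≥ 0}` be compact and let
`f ∈ ℝ[x,t]` have degree at most `2d` in `t` with coefficient of `t^{2d}` strictly positive
on `K`.  If `f > 0` on `K × ℝ` then `f` lies in the preordering generated by the `gⱼ`,
i.e. `f = ∑_{β ∈ {0,1}^m} ψ_β ⬝ g^β` with each `ψ_β` a sum of squares in `ℝ[x,t]`. -/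
theorem mem_preordering_of_pos_on_prod
    {n m : ℕ} (g : Fin m → MvPolynomial (Fin n) ℝ)
    (K : Set (Fin n → ℝ))
    (hKdef : K = {x : Fin n → ℝ | ∀ j, 0 ≤ MvPolynomial.eval x (g j)})
    (hK : IsCompact K)
    (d : ℕ) (f : Polynomial (MvPolynomial (Fin n) ℝ))
    (hdeg : f.natDegree ≤ 2 * d)
    (hlead : ∀ x ∈ K, 0 < MvPolynomial.eval x (f.coeff (2 * d)))
    (hpos : ∀ x ∈ K, ∀ t : ℝ, 0 < Polynomial.eval₂ (MvPolynomial.eval x) t f) :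
    ∃ ψ : (Fin m → Bool) → Polynomial (MvPolynomial (Fin n) ℝ),
      (∀ β, IsSumSq (ψ β)) ∧
      f = ∑ β : Fin m → Bool,
            ψ β * Polynomial.C (∏ j, if β j then g j else 1) := by
  subst hKdef
  apply exists_isSumSq_of_mem_boundedPreordering (d := d)
  have hP : ∀ c : ℝ, 0 ≤ c →
      algebraMap ℝ (MvPolynomial (Fin n) ℝ) c ∈ preorderingClosure g :=
    fun c hc => MvPolynomial.C_mem_of_nonneg (mul_self_mem_preorderingClosure g) hc
  have harch : ∀ a, ∃ c : ℝ, algebraMap ℝ (MvPolynomial (Fin n) ℝ) c - a ∈ preorderingClosure g :=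
    preorderingClosure_archimedean g hK
  let V := degreeLE (MvPolynomial (Fin n) ℝ) ((2 * d : ℕ) : WithBot ℕ)
  have hV : ∀ {v : (MvPolynomial (Fin n) ℝ)[X]}, v.natDegree ≤ 2 * d → v ∈ V :=
    fun hv => mem_degreeLE.2 (natDegree_le_iff_degree_le.1 hv)
  let M : AddSubmonoid V := (boundedPreordering g d).comap V.subtype.toAddMonoidHom
  let e : V := ⟨∑ k ∈ Finset.range (d + 1), X ^ (2 * k), sum_mem fun k hk =>
    hV ((natDegree_X_pow_le _).trans (by have := Finset.mem_range.1 hk; omega))⟩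
  suffices H : (⟨f, hV hdeg⟩ : V) ∈ M from H
  refine mem_of_forall_pure_state_pos (preorderingClosure g) hP harch M (e := e) ?_ ?_ ?_ ?_
  · intro a ha v hv
    change a • (v : (MvPolynomial (Fin n) ℝ)[X]) ∈ boundedPreordering g d
    rw [smul_eq_C_mul]
    exact C_mul_mem_boundedPreordering ha hv
  · exact sum_pow_mem_boundedPreordering g subset_rfl
  · intro v
    exact exists_smul_sum_add_mem_boundedPreordering hP harch
      (natDegree_le_iff_degree_le.2 (mem_degreeLE.1 v.2))
  · intro L χ hLM hLe hχ hLχ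
    have hx : ∀ p, MvPolynomial.eval (fun i => χ (MvPolynomial.X i)) p = χ p := fun p => by
      rw [← MvPolynomial.coe_aeval_eq_eval]
      exact (DFunLike.congr_fun (MvPolynomial.aeval_unique χ) p).symm
    have hxK : (fun i => χ (MvPolynomial.X i)) ∈
        {x : Fin n → ℝ | ∀ j, 0 ≤ MvPolynomial.eval x (g j)} := fun j => by
      rw [hx]
      exact hχ _ (squareMultiples_subset_preorderingClosure (self_mem_squareMultiples g j))
    have hring : MvPolynomial.eval (fun i => χ (MvPolynomial.X i)) =
        (χ : MvPolynomial (Fin n) ℝ →+* ℝ) := RingHom.ext hx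
    obtain ⟨ε, hε, hle⟩ := exists_pos_mul_sum_le d
      (f.map (χ : MvPolynomial (Fin n) ℝ →+* ℝ)) (natDegree_map_le.trans hdeg)
      (by simpa [hring] using hlead _ hxK)
      (fun t => by simpa [hring, eval_map] using hpos _ hxK t)
    let r : ℝ[X] := f.map (χ : MvPolynomial (Fin n) ℝ →+* ℝ) -
      C ε * ∑ k ∈ Finset.range (d + 1), X ^ (2 * k)
    have hrdeg : r.natDegree ≤ 2 * d := by
      refine (natDegree_sub_le_of_le (natDegree_map_le.trans hdeg) ((natDegree_C_mul_le _ _).trans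
        (natDegree_sum_le_of_forall_le _ _ fun k hk => ?_))).trans (max_self _).le
      exact (natDegree_X_pow_le _).trans (by have := Finset.mem_range.1 hk; omega)
    have hr := map_mem_boundedPreordering g (mem_closure_sq_of_nonneg d r hrdeg fun t => by
      simpa [r, eval_finsetSum] using hle t)
    have hzero := eq_zero_of_map_eq_zero hLχ
      (⟨f, hV hdeg⟩ - (⟨_, hV (natDegree_map_le.trans hrdeg)⟩ + ε • e)) (by
        have hcomp : (χ : MvPolynomial (Fin n) ℝ →+* ℝ).comp
            (algebraMap ℝ (MvPolynomial (Fin n) ℝ)) = RingHom.id ℝ :=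
          RingHom.ext fun c => χ.commutes c
        have hmap : (r.map (algebraMap ℝ (MvPolynomial (Fin n) ℝ))).map
            (χ : MvPolynomial (Fin n) ℝ →+* ℝ) = r := by
          rw [Polynomial.map_map, hcomp, Polynomial.map_id]
        have hmape : ((ε • e : V) : (MvPolynomial (Fin n) ℝ)[X]).map
            (χ : MvPolynomial (Fin n) ℝ →+* ℝ) =
            C ε * ∑ k ∈ Finset.range (d + 1), X ^ (2 * k) := by
          rw [← algebraMap_smul (MvPolynomial (Fin n) ℝ) ε e, Submodule.coe_smul, smul_eq_C_mul,
            Polynomial.map_mul, map_C, Polynomial.map_sum]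
          congr 1
          · exact congrArg C (χ.commutes ε)
          · simp
        rw [Submodule.coe_sub, Submodule.coe_add, Polynomial.map_sub, Polynomial.map_add, hmap,
          hmape, sub_add_cancel, sub_self])
    rw [map_sub, map_add, map_smul, hLe, sub_eq_zero] at hzero
    rw [hzero]
    have := hLM _ (show (⟨_, hV (natDegree_map_le.trans hrdeg)⟩ : V) ∈ M from hr)
    simp only [smul_eq_mul, mul_one]
    linarith
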